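/- arXiv:1908.00842 — 2 statements merged into one kernel-verified Lean document; each statement's English description precedes it below -/
import Mathlib

section
/- Fix an integer m ≥ 1 and let ζ = exp(2πi/m). Let a : ZMod m → ℕ be a minimal v-sum with reduced exponent k. Then k is squarefree, and ∑_{i : ZMod m} a i ≥ 2 + ∑_{p prime, p ∣ k} (p − 2). -/
/-- The primitive complex `m`-th root of unity `exp(2πi/m)`. -/
noncomputable def zetaC (m : ℕ) : ℂ := Complex.exp (2 * Real.pi * Complex.I / m)

/-- `a : ZMod m → ℕ` is a v-sum (vanishing sum) if it is not identically zero and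
`∑ i, a i • ζ_m^i = 0`. -/
noncomputable def IsVSum (m : ℕ) [NeZero m] (a : ZMod m → ℕ) : Prop :=
  a ≠ 0 ∧ ∑ i : ZMod m, (a i : ℂ) * zetaC m ^ i.val = 0

/-- A v-sum `a` is minimal if any v-sum `b ≤ a` equals `a`. -/
noncomputable def IsMinimalVSum (m : ℕ) [NeZero m] (a : ZMod m → ℕ) : Prop :=
  IsVSum m a ∧ ∀ b : ZMod m → ℕ, (∀ i, b i ≤ a i) → b ≠ 0 →
    (∑ i : ZMod m, (b i : ℂ) * zetaC m ^ i.val = 0) → b = a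

/-- `k` is the reduced exponent of `a`: the least positive integer `k` such that
there is `j` with `a j ≠ 0` and `k • (i - j) = 0` for every `i` in the support of `a`. -/
def HasReducedExponent (m : ℕ) [NeZero m] (a : ZMod m → ℕ) (k : ℕ) : Prop :=
  IsLeast {k : ℕ | 0 < k ∧ ∃ j : ZMod m, a j ≠ 0 ∧
    ∀ i : ZMod m, a i ≠ 0 → k • (i - j) = 0} k

/-- `k` is the c-exponent of `a`: the least positive integer expressible as the lcm of the
reduced exponents of the parts of some decomposition of `a` into minimal v-sums. -/
noncomputable def HasCExponent (m : ℕ) [NeZero m] (a : ZMod m → ℕ) (k : ℕ) : Prop :=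
  IsLeast {k : ℕ | 0 < k ∧ ∃ (t : ℕ) (b : Fin t → ZMod m → ℕ) (e : Fin t → ℕ),
    (∀ j, IsMinimalVSum m (b j)) ∧ a = ∑ j, b j ∧
    (∀ j, HasReducedExponent m (b j) (e j)) ∧
    k = (Finset.univ : Finset (Fin t)).lcm e} k


theorem conj_sum {n : ℕ} (hn : 0 < n) (S : Multiset ℂ) (h : ∀ x ∈ S, x ^ n = 1) (h0 : S.sum = 0)
    {t : ℕ} (ht : t.Coprime n) : (S.map (fun x => x ^ t)).sum = 0 := by
  have hz := Complex.isPrimitiveRoot_exp n hn.ne'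
  set z := Complex.exp (2 * Real.pi * Complex.I / n) with hzdef
  have hex : ∀ x : ℂ, ∃ i : ℕ, x ^ n = 1 → z ^ i = x := by
    intro x
    by_cases hx : x ^ n = 1
    · have : NeZero n := ⟨hn.ne'⟩
      obtain ⟨i, _, hi⟩ := hz.eq_pow_of_pow_eq_one hx
      exact ⟨i, fun _ => hi⟩
    · exact ⟨0, fun h => absurd h hx⟩
  choose e he using hex
  let f : Polynomial ℤ := (S.map (fun x => (Polynomial.X : Polynomial ℤ) ^ e x)).sum
  have hf : ∀ w : ℂ, Polynomial.aeval w f = (S.map (fun x => w ^ e x)).sum := by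
    intro w
    simp only [f]
    rw [map_multiset_sum, Multiset.map_map]
    simp
  have hint : IsIntegral ℤ z := hz.isIntegral hn
  have h1 : Polynomial.aeval z f = 0 := by
    rw [hf, ← h0]
    congr 1
    conv_rhs => rw [← Multiset.map_id S]
    exact Multiset.map_congr rfl (fun x hx => he x (h x hx))
  have h2 := minpoly.isIntegrallyClosed_dvd hint h1
  rw [hz.minpoly_eq_pow_coprime ht] at h2
  have h3 : Polynomial.aeval (z ^ t) f = 0 := by
    obtain ⟨g, hg⟩ := h2
    rw [hg, map_mul, minpoly.aeval, zero_mul]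
  rw [hf] at h3
  rw [← h3]
  congr 1
  refine Multiset.map_congr rfl (fun x hx => ?_)
  rw [← pow_mul, mul_comm, pow_mul, he x (h x hx)]

theorem fib {β : Type*} [DecidableEq β] (g : ℂ → β) (D : Finset β) (S : Multiset ℂ)
    (h : ∀ x ∈ S, g x ∈ D) : S = ∑ d ∈ D, S.filter (fun x => g x = d) := by
  induction S using Multiset.induction_on with
  | empty => simp
  | cons a S ih =>
    have h1 := ih (fun x hx => h x (Multiset.mem_cons_of_mem hx))
    have : ∀ d ∈ D, (a ::ₘ S).filter (fun x => g x = d)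
        = (if g a = d then {a} else 0) + S.filter (fun x => g x = d) := by
      intro d _
      rw [Multiset.filter_cons]
    rw [Finset.sum_congr rfl this, Finset.sum_add_distrib, ← h1, Finset.sum_ite_eq,
      if_pos (h a (Multiset.mem_cons_self a S))]
    simp

theorem geom_mu {p : ℕ} (c d : ℂ) (hc : c ^ p = 1) (hd : d ^ p = 1) (hp : 0 < p) :
    ∑ s ∈ Finset.range p, (d⁻¹) ^ s * c ^ s = if c = d then (p : ℂ) else 0 := by
  have hd0 : d ≠ 0 := by
    rintro rfl
    rw [zero_pow hp.ne'] at hd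
    exact zero_ne_one hd
  split_ifs with h
  · subst h
    have : ∀ s ∈ Finset.range p, (c⁻¹) ^ s * c ^ s = 1 := by
      intro s _
      rw [← mul_pow, inv_mul_cancel₀ hd0, one_pow]
    rw [Finset.sum_congr rfl this]
    simp
  · have h1 : d⁻¹ * c ≠ 1 := by
      intro h1
      apply h
      field_simp at h1
      exact h1
    simp_rw [← mul_pow]
    rw [geom_sum_eq h1, mul_pow, inv_pow, hc, hd]
    simp

theorem fourierFib {p N : ℕ} (hp : 0 < p) (S : Multiset ℂ) (h : ∀ x ∈ S, (x ^ N) ^ p = 1)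
    (d : ℂ) (hd : d ^ p = 1) :
    (p : ℂ) * (S.filter (fun x => x ^ N = d)).sum
      = ∑ s ∈ Finset.range p, (d⁻¹) ^ s * (S.map (fun x => x * (x ^ N) ^ s)).sum := by
  induction S using Multiset.induction_on with
  | empty => simp
  | cons a S ih =>
    have h1 := ih (fun x hx => h x (Multiset.mem_cons_of_mem hx))
    have h2 := geom_mu (a ^ N) d (h a (Multiset.mem_cons_self a S)) hd hp
    simp only [Multiset.map_cons, Multiset.sum_cons, mul_add, Finset.sum_add_distrib]
    rw [← h1]
    have h3 : ∑ s ∈ Finset.range p, (d⁻¹) ^ s * (a * (a ^ N) ^ s)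
        = a * (if a ^ N = d then (p : ℂ) else 0) := by
      rw [← h2, Finset.mul_sum]
      exact Finset.sum_congr rfl (fun s _ => by ring)
    rw [h3, Multiset.filter_cons]
    split_ifs <;> simp <;> ring

theorem conj_map {p N s : ℕ} (hp : 0 < p) (hN : 0 < N) (S : Multiset ℂ)
    (h : ∀ x ∈ S, x ^ (p * N) = 1) (h0 : S.sum = 0) (hc : (1 + s * N).Coprime p) :
    (S.map (fun x => x * (x ^ N) ^ s)).sum = 0 := by
  have hcn : (1 + s * N).Coprime (p * N) := by
    refine Nat.Coprime.mul_right hc ?_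
    simp
  rw [← conj_sum (Nat.mul_pos hp hN) S h h0 hcn]
  congr 1
  refine Multiset.map_congr rfl (fun x _ => ?_)
  rw [pow_add, pow_one, mul_comm s N, pow_mul]

theorem lemSq {p N : ℕ} (hp : p.Prime) (hN : 0 < N) (hpN : p ∣ N) (S : Multiset ℂ)
    (h : ∀ x ∈ S, x ^ (p * N) = 1) (h0 : S.sum = 0) (d : ℂ) (hd : d ^ p = 1) :
    (S.filter (fun x => x ^ N = d)).sum = 0 := by
  have h1 := fourierFib (N := N) hp.pos S (fun x hx => by rw [← pow_mul, mul_comm, h x hx]) d hd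
  rw [Finset.sum_eq_zero] at h1
  · have : (p : ℂ) ≠ 0 := by exact_mod_cast hp.ne_zero
    simpa [this] using h1
  · intro s _
    rw [conj_map hp.pos hN S h h0, mul_zero]
    obtain ⟨r, rfl⟩ := hpN
    rw [mul_left_comm]
    simp

theorem lemA {p N : ℕ} (hp : p.Prime) (hN : 0 < N) (hpN : ¬ p ∣ N) :
    ∃ s0 : ℕ, p ∣ 1 + s0 * N ∧ ∀ (S : Multiset ℂ),
    (∀ x ∈ S, x ^ (p * N) = 1) → (S.sum = 0) → ∃ K : ℂ, ∀ d : ℂ, d ^ p = 1 →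
    d ^ s0 * (S.filter (fun x => x ^ N = d)).sum = K := by
  have : ∃ s0 < p, p ∣ 1 + s0 * N := by
    have := Fact.mk hp
    have hN0 : (N : ZMod p) ≠ 0 := by rwa [Ne, ZMod.natCast_eq_zero_iff]
    refine ⟨(-(N : ZMod p)⁻¹).val, ZMod.val_lt _, ?_⟩
    rw [← ZMod.natCast_eq_zero_iff]
    push_cast
    rw [ZMod.natCast_val, ZMod.cast_id]
    field_simp
    ring
  obtain ⟨s0, hs, hs0⟩ := this
  refine ⟨s0, hs0, fun S h h0 => ⟨(S.map (fun x => x * (x ^ N) ^ s0)).sum / p, fun d hd => ?_⟩⟩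
  have h1 := fourierFib (N := N) hp.pos S (fun x hx => by rw [← pow_mul, mul_comm, h x hx]) d hd
  have hp0 : (p : ℂ) ≠ 0 := by exact_mod_cast hp.ne_zero
  have hd0 : d ≠ 0 := by
    rintro rfl
    rw [zero_pow hp.ne_zero] at hd
    exact zero_ne_one hd
  rw [Finset.sum_eq_single_of_mem s0 (Finset.mem_range.2 hs)] at h1
  · rw [eq_div_iff hp0, mul_assoc, mul_comm _ (p : ℂ), h1, ← mul_assoc, ← mul_pow,
      mul_inv_cancel₀ hd0, one_pow, one_mul]
  · intro s hsr hne
    rw [conj_map hp.pos hN S h h0, mul_zero]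
    rw [Nat.coprime_comm, hp.coprime_iff_not_dvd]
    intro hdv
    apply hne
    have hm : 1 + s * N ≡ 1 + s0 * N [MOD p] :=
      ((Nat.modEq_zero_iff_dvd.2 hdv)).trans (Nat.modEq_zero_iff_dvd.2 hs0).symm
    have hm2 := Nat.ModEq.cancel_right_of_coprime
      (by exact (hp.coprime_iff_not_dvd.2 hpN)) (Nat.ModEq.add_left_cancel' 1 hm)
    exact Nat.ModEq.eq_of_lt_of_lt hm2 (Finset.mem_range.1 hsr) hs

theorem arith {α : Type*} [DecidableEq α] (D : Finset α) (c0 : α) (l : α → ℕ) (t : ℕ)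
    (Q : α → Finset ℕ) (w : ℕ → ℕ) (A : Finset ℕ) (hmin : ∀ c ∈ D, t + 1 ≤ l c)
    (hcov : ∀ q ∈ A, ∃ c ∈ D, c ≠ c0 ∧ q ∈ Q c)
    (hb : ∀ c ∈ D, c ≠ c0 → 2 + ∑ q ∈ Q c, w q ≤ l c + (t + 1))
    (hA : 2 * A.card ≤ D.card) : D.card + ∑ q ∈ A, w q ≤ ∑ c ∈ D, l c := by
  have : ∀ q, ∃ c, q ∈ A → c ∈ D ∧ c ≠ c0 ∧ q ∈ Q c := by
    intro q
    by_cases hq : q ∈ A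
    · obtain ⟨c, hc⟩ := hcov q hq
      exact ⟨c, fun _ => hc⟩
    · exact ⟨c0, fun h => absurd h hq⟩
  choose f hf using this
  have hpt : ∀ c ∈ D, t + 1 + ∑ q ∈ A with f q = c, w q
      ≤ l c + (A.filter (fun q => f q = c)).card * (2 * t) := by
    intro c hc
    rcases (A.filter (fun q => f q = c)).eq_empty_or_nonempty with h | h
    · rw [h]
      simpa using hmin c hc
    · have hsub : A.filter (fun q => f q = c) ⊆ Q c := by
        intro q hq
        rw [Finset.mem_filter] at hq
        rw [← hq.2]
        exact (hf q hq.1).2.2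
      have hne : c ≠ c0 := by
        obtain ⟨q, hq⟩ := h
        rw [Finset.mem_filter] at hq
        rw [← hq.2]
        exact (hf q hq.1).2.1
      have h1 := hb c hc hne
      have h2 := Finset.sum_le_sum_of_subset (f := w) hsub
      have h3 := Nat.mul_le_mul_right (2 * t) (Finset.card_pos.2 h)
      omega
  have hs := Finset.sum_le_sum hpt
  simp only [Finset.sum_add_distrib] at hs
  rw [← Finset.sum_mul,
    Finset.sum_fiberwise_of_maps_to (fun q hq => (hf q hq).1),
    ← Finset.card_eq_sum_card_fiberwise (fun q hq => (hf q hq).1)] at hs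
  simp only [Finset.sum_const, smul_eq_mul] at hs
  nlinarith [Nat.mul_le_mul_right t hA]

noncomputable def act (n : ℕ) (S : Multiset ℂ) : Finset ℕ := by
  classical
  exact n.primeFactors.filter (fun q => q ≠ 2 ∧ ∃ x ∈ S, ∃ y ∈ S, x ^ (n / q) ≠ y ^ (n / q))

theorem mem_act {n : ℕ} {S : Multiset ℂ} {q : ℕ} : q ∈ act n S ↔
    q ∈ n.primeFactors ∧ q ≠ 2 ∧ ∃ x ∈ S, ∃ y ∈ S, x ^ (n / q) ≠ y ^ (n / q) := by
  unfold act
  simp only [Finset.mem_filter]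

def MinV (S : Multiset ℂ) : Prop := ∀ T ≤ S, T ≠ 0 → T.sum = 0 → T = S

theorem min_act {n : ℕ} {S : Multiset ℂ} (hS : MinV S) {q : ℕ} (hq : q ∈ act n S) :
    ∃ d, (S.filter (fun x => x ^ (n / q) = d)).sum ≠ 0 := by
  obtain ⟨_, _, x, hx, y, hy, hxy⟩ := mem_act.1 hq
  refine ⟨x ^ (n / q), fun h => ?_⟩
  have h1 := hS _ (Multiset.filter_le _ S) (fun h0 => by
    have : x ∈ S.filter (fun z => z ^ (n / q) = x ^ (n / q)) := Multiset.mem_filter.2 ⟨hx, rfl⟩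
    rw [h0] at this
    simp at this) h
  have h2 := Multiset.filter_eq_self.1 h1 y hy
  exact hxy h2.symm

theorem card_odd (p : ℕ) (hp3 : 3 ≤ p) (hodd : p % 2 = 1) (A : Finset ℕ)
    (h : ∀ q ∈ A, 3 ≤ q ∧ q % 2 = 1 ∧ q < p) : 2 * A.card ≤ p := by
  have : A.card ≤ (Finset.range ((p - 3) / 2)).card := by
    refine Finset.card_le_card_of_injOn (fun q => (q - 3) / 2) ?_ ?_
    · intro q hq
      have := h q hq
      simp only [Finset.coe_range, Set.mem_Iio]
      omega
    · intro q hq q' hq' he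
      have := h q hq
      have := h q' hq'
      simp only at he
      omega
  rw [Finset.card_range] at this
  omega

def Good (n : ℕ) (S : Multiset ℂ) : Prop := ∃ Q ⊆ act n S, 2 + ∑ q ∈ Q, (q - 2) ≤ S.card ∧
  ∀ q ∈ n.primeFactors, q ≠ 2 → q ∉ Q → ∀ c, (S.filter (fun x => x ^ (n / q) = c)).sum = 0

theorem act_mono {n : ℕ} {S T : Multiset ℂ} (h : T ≤ S) : act n T ⊆ act n S := by
  intro q hq
  obtain ⟨h1, h2, x, hx, y, hy, hxy⟩ := mem_act.1 hq
  exact mem_act.2 ⟨h1, h2, x, Multiset.mem_of_le h hx, y, Multiset.mem_of_le h hy, hxy⟩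

theorem good_add {n : ℕ} {S T : Multiset ℂ} (hS : Good n S) (hT : Good n T) : Good n (S + T) := by
  obtain ⟨Q, h1, h2, h3⟩ := hS
  obtain ⟨R, g1, g2, g3⟩ := hT
  refine ⟨Q ∪ R, Finset.union_subset (h1.trans (act_mono (Multiset.le_add_right _ _)))
    (g1.trans (act_mono (Multiset.le_add_left _ _))), ?_, ?_⟩
  · have := Finset.sum_union_inter (s₁ := Q) (s₂ := R) (f := fun q => q - 2)
    rw [Multiset.card_add]
    omega
  · intro q hq hq2 hqn c
    rw [Finset.notMem_union] at hqn
    rw [Multiset.filter_add, Multiset.sum_add, h3 q hq hq2 hqn.1 c, g3 q hq hq2 hqn.2 c, add_zero]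

theorem good_min {n : ℕ} (hn : Squarefree n) (h2n : 2 ∣ n) (S : Multiset ℂ) (hS0 : S ≠ 0)
    (hSn : ∀ x ∈ S, x ^ n = 1) (hsum : S.sum = 0) (hmin : MinV S)
    (ih : ∀ T : Multiset ℂ, T ≠ 0 → (∀ x ∈ T, x ^ n = 1) → T.sum = 0 →
      (act n T).card < (act n S).card → Good n T) : Good n S := by
  classical
  have hn0 : n ≠ 0 := hn.ne_zero
  refine ⟨act n S, subset_rfl, ?_, ?_⟩
  swap
  · intro q hq hq2 hqn c
    by_cases h : ∃ x ∈ S, x ^ (n / q) = c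
    · obtain ⟨x, hx, hxc⟩ := h
      rw [Multiset.filter_eq_self.2, hsum]
      intro y hy
      by_contra hne
      exact hqn (mem_act.2 ⟨hq, hq2, x, hx, y, hy, fun h => hne (h ▸ hxc)⟩)
    · push Not at h
      rw [Multiset.filter_eq_nil.2 h]
      simp
  rcases (act n S).eq_empty_or_nonempty with he | hne
  · rw [he]
    simp only [Finset.sum_empty]
    have h1 : S.card ≠ 0 := by simpa using hS0
    have h2 : S.card ≠ 1 := by
      intro h
      obtain ⟨x, rfl⟩ := Multiset.card_eq_one.1 h
      have := hSn x (by simp)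
      simp only [Multiset.sum_singleton] at hsum
      rw [hsum, zero_pow hn0] at this
      exact zero_ne_one this
    omega
  -- the largest prime
  set p := (act n S).max' hne with hpdef
  have hpA : p ∈ act n S := Finset.max'_mem _ _
  obtain ⟨hpn, hp2, -⟩ := mem_act.1 hpA
  have hp : p.Prime := Nat.prime_of_mem_primeFactors hpn
  obtain ⟨N, hN⟩ := Nat.dvd_of_mem_primeFactors hpn
  have hNdiv : n / p = N := by rw [hN, Nat.mul_div_cancel_left _ hp.pos]
  have hN0 : 0 < N := Nat.pos_of_ne_zero (by rintro rfl; exact hn0 (by simpa using hN))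
  have hpN : ¬ p ∣ N := by
    rintro ⟨r, rfl⟩
    have := hn p ⟨r, by rw [hN, mul_assoc]⟩
    exact hp.one_lt.ne' (Nat.isUnit_iff.1 this)
  have h2p : Nat.Coprime 2 p := (Nat.coprime_primes Nat.prime_two hp).2 (Ne.symm hp2)
  have hNeven : Even N := even_iff_two_dvd.2 (h2p.dvd_of_dvd_mul_left (hN ▸ h2n))
  obtain ⟨s0, hs0, hK⟩ := lemA hp hN0 hpN
  have hSpN : ∀ x ∈ S, x ^ (p * N) = 1 := fun x hx => by rw [← hN, hSn x hx]
  obtain ⟨K, hK⟩ := hK S hSpN hsum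
  set D := Polynomial.nthRootsFinset p (1 : ℂ) with hD
  have hDmem : ∀ c, c ∈ D ↔ c ^ p = 1 := fun c => Polynomial.mem_nthRootsFinset hp.pos 1
  have hDcard : D.card = p := (Complex.isPrimitiveRoot_exp p hp.ne_zero).card_nthRootsFinset
  have hD0 : ∀ c ∈ D, c ≠ 0 := by
    rintro c hc rfl
    rw [hDmem, zero_pow hp.ne_zero] at hc
    exact zero_ne_one hc
  have hmaps : ∀ x ∈ S, x ^ N ∈ D := fun x hx => by
    rw [hDmem, ← pow_mul, mul_comm, hSpN x hx]
  let F : ℂ → Multiset ℂ := fun c => S.filter (fun x => x ^ N = c)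
  have hFD : S = ∑ c ∈ D, F c := fib (fun x => x ^ N) D S hmaps
  have hK0 : K ≠ 0 := by
    intro h0
    obtain ⟨d, hd⟩ := min_act hmin hpA
    rw [hNdiv] at hd
    by_cases hdD : d ∈ D
    · have := hK d ((hDmem d).1 hdD)
      rw [h0] at this
      rcases mul_eq_zero.1 this with h | h
      · exact hD0 d hdD (eq_zero_of_pow_eq_zero h)
      · exact hd h
    · apply hd
      rw [Multiset.filter_eq_nil.2]
      · simp
      · rintro x hx rfl
        exact hdD (hmaps x hx)
  have hKF : ∀ c ∈ D, (F c).sum = (c ^ s0)⁻¹ * K := by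
    intro c hc
    rw [← hK c ((hDmem c).1 hc), inv_mul_cancel_left₀ (pow_ne_zero _ (hD0 c hc))]
  have hW : ∑ c ∈ D, (c ^ s0)⁻¹ = 0 := by
    have h1 : (∑ c ∈ D, F c).sum = 0 := by rw [← hFD, hsum]
    rw [Multiset.sum_sum, Finset.sum_congr rfl hKF, ← Finset.sum_mul] at h1
    exact (mul_eq_zero.1 h1).resolve_right hK0
  have hFne : ∀ c ∈ D, F c ≠ 0 := by
    intro c hc h
    have := hKF c hc
    rw [h, Multiset.sum_zero] at this
    exact mul_ne_zero (inv_ne_zero (pow_ne_zero _ (hD0 c hc))) hK0 this.symm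
  have hDne : D.Nonempty := Finset.card_pos.1 (by rw [hDcard]; exact hp.pos)
  obtain ⟨c0, hc0, hc0min⟩ := Finset.exists_min_image D (fun c => (F c).card) hDne
  obtain ⟨t, ht⟩ : ∃ t, (F c0).card = t + 1 :=
    Nat.exists_eq_succ_of_ne_zero (by simpa using hFne c0 hc0)
  let T : ℂ → Multiset ℂ := fun c =>
    (F c).map (fun x => c ^ s0 * x) + (F c0).map (fun x => -(c0 ^ s0) * x)
  have hFp : ∀ c ∈ D, ∀ x ∈ F c, (c ^ s0 * x) ^ N = 1 := by
    intro c hc x hx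
    have hxc := (Multiset.mem_filter.1 hx).2
    obtain ⟨r, hr⟩ := hs0
    rw [mul_pow, hxc, ← pow_mul, ← pow_succ, add_comm, hr, pow_mul, (hDmem c).1 hc, one_pow]
  have hTp : ∀ c ∈ D, ∀ x ∈ T c, x ^ N = 1 := by
    intro c hc x hx
    rcases Multiset.mem_add.1 hx with h | h
    · obtain ⟨y, hy, rfl⟩ := Multiset.mem_map.1 h
      exact hFp c hc y hy
    · obtain ⟨y, hy, rfl⟩ := Multiset.mem_map.1 h
      rw [neg_mul, hNeven.neg_pow]
      exact hFp c0 hc0 y hy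
  have hTn : ∀ c ∈ D, ∀ x ∈ T c, x ^ n = 1 := by
    intro c hc x hx
    rw [hN, mul_comm, pow_mul, hTp c hc x hx, one_pow]
  -- the `q`-coordinates do not change
  have hq1 : ∀ q ∈ n.primeFactors, q ≠ 2 → q ≠ p → ∀ c ∈ D, ∀ x : ℂ,
      (c ^ s0 * x) ^ (n / q) = x ^ (n / q) ∧ (-(c ^ s0) * x) ^ (n / q) = x ^ (n / q) := by
    intro q hq hq2 hqp c hc x
    have hqP := Nat.prime_of_mem_primeFactors hq
    have hqn := Nat.mul_div_cancel' (Nat.dvd_of_mem_primeFactors hq)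
    have hpd : p ∣ n / q := ((Nat.coprime_primes hp hqP).2 (Ne.symm hqp)).dvd_of_dvd_mul_left
      (hqn.symm ▸ ⟨N, hN⟩)
    have h2d : 2 ∣ n / q := ((Nat.coprime_primes Nat.prime_two hqP).2
      (Ne.symm hq2)).dvd_of_dvd_mul_left (hqn.symm ▸ h2n)
    have h1 : (c ^ s0 * x) ^ (n / q) = x ^ (n / q) := by
      obtain ⟨r, hr⟩ := hpd
      rw [mul_pow, ← pow_mul, mul_comm s0, pow_mul, hr, pow_mul c, (hDmem c).1 hc]
      simp
    refine ⟨h1, ?_⟩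
    rw [neg_mul, (even_iff_two_dvd.2 h2d).neg_pow, h1]
  have hact : ∀ c ∈ D, act n (T c) ⊆ (act n S).erase p := by
    intro c hc q hq
    obtain ⟨h1, h2, x, hx, y, hy, hxy⟩ := mem_act.1 hq
    have hqp : q ≠ p := by
      rintro rfl
      rw [hNdiv] at hxy
      exact hxy (by rw [hTp c hc x hx, hTp c hc y hy])
    have key : ∀ x ∈ T c, ∃ x' ∈ S, x ^ (n / q) = x' ^ (n / q) := by
      intro x hx
      rcases Multiset.mem_add.1 hx with h | h
      · obtain ⟨y, hy, rfl⟩ := Multiset.mem_map.1 h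
        exact ⟨y, (Multiset.mem_filter.1 hy).1, (hq1 q h1 h2 hqp c hc y).1⟩
      · obtain ⟨y, hy, rfl⟩ := Multiset.mem_map.1 h
        exact ⟨y, (Multiset.mem_filter.1 hy).1, (hq1 q h1 h2 hqp c0 hc0 y).2⟩
    obtain ⟨x', hx', ex⟩ := key x hx
    obtain ⟨y', hy', ey⟩ := key y hy
    exact Finset.mem_erase.2 ⟨hqp, mem_act.2 ⟨h1, h2, x', hx', y', hy', by rwa [← ex, ← ey]⟩⟩
  have hTne : ∀ c ∈ D, T c ≠ 0 := by
    intro c hc h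
    have := congrArg Multiset.card h
    simp only [T, Multiset.card_add, Multiset.card_map, ht, Multiset.card_zero] at this
    omega
  have hTsum : ∀ c ∈ D, (T c).sum = 0 := by
    intro c hc
    simp only [T]
    rw [Multiset.sum_add, Multiset.sum_map_mul_left, Multiset.sum_map_mul_left, Multiset.map_id',
      Multiset.map_id', neg_mul, hK c ((hDmem c).1 hc), hK c0 ((hDmem c0).1 hc0)]
    ring
  have hgood : ∀ c, ∃ Q : Finset ℕ, c ∈ D → Q ⊆ act n (T c) ∧
      2 + ∑ q ∈ Q, (q - 2) ≤ (T c).card ∧ ∀ q ∈ n.primeFactors, q ≠ 2 → q ∉ Q →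
      ∀ d, ((T c).filter (fun x => x ^ (n / q) = d)).sum = 0 := by
    intro c
    by_cases hc : c ∈ D
    · obtain ⟨Q, hQ⟩ := ih (T c) (hTne c hc) (hTn c hc) (hTsum c hc)
        ((Finset.card_le_card (hact c hc)).trans_lt (Finset.card_erase_lt_of_mem hpA))
      exact ⟨Q, fun _ => hQ⟩
    · exact ⟨∅, fun h => absurd h hc⟩
  choose Q hQ using hgood
  have hcov : ∀ q ∈ (act n S).erase p, ∃ c ∈ D, c ≠ c0 ∧ q ∈ Q c := by
    intro q hq
    obtain ⟨hqp, hqA⟩ := Finset.mem_erase.1 hq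
    obtain ⟨hqn, hq2, -⟩ := mem_act.1 hqA
    by_contra hcon
    push Not at hcon
    obtain ⟨d, hd⟩ := min_act hmin hqA
    apply hd
    have hX : ∀ c ∈ D, ((F c).filter (fun x => x ^ (n / q) = d)).sum
        = (c ^ s0)⁻¹ * (c0 ^ s0 * ((F c0).filter (fun x => x ^ (n / q) = d)).sum) := by
      intro c hc
      by_cases hcc : c = c0
      · rw [hcc, inv_mul_cancel_left₀ (pow_ne_zero _ (hD0 c0 hc0))]
      have h1 := (hQ c hc).2.2 q hqn hq2 (hcon c hc hcc) d
      simp only [T] at h1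
      rw [Multiset.filter_add, Multiset.filter_map, Multiset.filter_map, Multiset.sum_add,
        Multiset.sum_map_mul_left, Multiset.sum_map_mul_left, Multiset.map_id',
        Multiset.map_id'] at h1
      have e1 : (F c).filter ((fun x => x ^ (n / q) = d) ∘ fun x => c ^ s0 * x)
          = (F c).filter (fun x => x ^ (n / q) = d) :=
        Multiset.filter_congr (fun x _ => by
          simp only [Function.comp]
          rw [(hq1 q hqn hq2 hqp c hc x).1])
      have e2 : (F c0).filter ((fun x => x ^ (n / q) = d) ∘ fun x => -(c0 ^ s0) * x)
          = (F c0).filter (fun x => x ^ (n / q) = d) :=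
        Multiset.filter_congr (fun x _ => by
          simp only [Function.comp]
          rw [(hq1 q hqn hq2 hqp c0 hc0 x).2])
      rw [e1, e2, neg_mul, ← sub_eq_add_neg, sub_eq_zero] at h1
      rw [← h1, inv_mul_cancel_left₀ (pow_ne_zero _ (hD0 c hc))]
    have h3 : S.filter (fun x => x ^ (n / q) = d)
        = ∑ c ∈ D, (F c).filter (fun x => x ^ (n / q) = d) := by
      have := fib (fun x => x ^ N) D (S.filter (fun x => x ^ (n / q) = d))
        (fun x hx => hmaps x (Multiset.mem_filter.1 hx).1)
      rw [this]
      refine Finset.sum_congr rfl (fun c _ => ?_)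
      exact Multiset.filter_comm _ _ S
    rw [h3, Multiset.sum_sum, Finset.sum_congr rfl hX, ← Finset.sum_mul, hW, zero_mul]
  have hp3 : 3 ≤ p := by
    have := hp.two_le
    omega
  have hoddp : p % 2 = 1 := hp.eq_two_or_odd.resolve_left hp2
  have hcardA : 2 * ((act n S).erase p).card ≤ p := by
    refine card_odd p hp3 hoddp _ (fun q hq => ?_)
    obtain ⟨hqp, hqA⟩ := Finset.mem_erase.1 hq
    obtain ⟨hqn, hq2, -⟩ := mem_act.1 hqA
    have hqP := Nat.prime_of_mem_primeFactors hqn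
    have h1 := hqP.two_le
    have h2 := hqP.eq_two_or_odd.resolve_left hq2
    have h3 : q ≤ p := Finset.le_max' _ _ hqA
    omega
  have hfin := arith D c0 (fun c => (F c).card) t Q (fun q => q - 2) ((act n S).erase p)
    (fun c hc => ht ▸ hc0min c hc) hcov
    (fun c hc _ => by
      have := (hQ c hc).2.1
      simpa only [T, Multiset.card_add, Multiset.card_map, ht] using this)
    (by rw [hDcard]; exact hcardA)
  have hcS : S.card = ∑ c ∈ D, (F c).card := by
    conv_lhs => rw [hFD]
    rw [Multiset.card_sum]
  rw [hcS, ← Finset.add_sum_erase _ _ hpA]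
  rw [hDcard] at hfin
  omega

theorem good_all {n : ℕ} (hn : Squarefree n) (h2n : 2 ∣ n) : ∀ (a b : ℕ) (S : Multiset ℂ),
    (act n S).card ≤ a → S.card ≤ b → S ≠ 0 → (∀ x ∈ S, x ^ n = 1) → S.sum = 0 → Good n S := by
  classical
  intro a
  induction a using Nat.strong_induction_on with
  | _ a iha =>
  intro b
  induction b with
  | zero =>
    intro S _ hb h0
    exact absurd (Multiset.card_eq_zero.1 (Nat.le_zero.1 hb)) h0
  | succ b ihb =>
    intro S ha hb h0 hSn hsum
    by_cases hmin : MinV S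
    · exact good_min hn h2n S h0 hSn hsum hmin (fun T hT0 hTn hTs hlt =>
        iha _ (hlt.trans_le ha) T.card T le_rfl le_rfl hT0 hTn hTs)
    · unfold MinV at hmin
      push Not at hmin
      obtain ⟨T, hTS, hT0, hTs, hne⟩ := hmin
      obtain ⟨U, rfl⟩ := Multiset.le_iff_exists_add.1 hTS
      have hU0 : U ≠ 0 := by
        rintro rfl
        simp at hne
      have c1 : T.card ≠ 0 := by simpa using hT0
      have c2 : U.card ≠ 0 := by simpa using hU0
      rw [Multiset.card_add] at hb
      rw [Multiset.sum_add, hTs, zero_add] at hsum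
      refine good_add (ihb T ?_ (by omega) hT0 (fun x hx => hSn x (Multiset.mem_add.2 (Or.inl hx)))
        hTs) (ihb U ?_ (by omega) hU0 (fun x hx => hSn x (Multiset.mem_add.2 (Or.inr hx))) hsum)
      · exact (Finset.card_le_card (act_mono (Multiset.le_add_right _ _))).trans ha
      · exact (Finset.card_le_card (act_mono (Multiset.le_add_left _ _))).trans ha

theorem min_bound {n : ℕ} (hn : Squarefree n) (h2n : 2 ∣ n) (S : Multiset ℂ) (hS0 : S ≠ 0)
    (hSn : ∀ x ∈ S, x ^ n = 1) (hsum : S.sum = 0) (hmin : MinV S) :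
    2 + ∑ q ∈ act n S, (q - 2) ≤ S.card := by
  obtain ⟨Q, h1, h2, h3⟩ := good_all hn h2n _ _ S le_rfl le_rfl hS0 hSn hsum
  have : Q = act n S := by
    refine Finset.Subset.antisymm h1 (fun q hq => ?_)
    by_contra hqQ
    obtain ⟨d, hd⟩ := min_act hmin hq
    obtain ⟨hqn, hq2, -⟩ := mem_act.1 hq
    exact hd (h3 q hqn hq2 hqQ d)
  rwa [this] at h2

theorem sum_replicate_facts {m : ℕ} [NeZero m] (e : ZMod m → ℂ) (he : Function.Injective e)
    (b : ZMod m → ℕ) : (∀ i, (∑ i, Multiset.replicate (b i) (e i)).count (e i) = b i) ∧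
    (∑ i, Multiset.replicate (b i) (e i)).card = ∑ i, b i ∧
    (∑ i, Multiset.replicate (b i) (e i)).sum = ∑ i, (b i : ℂ) * e i ∧
    (∀ x, x ∈ (∑ i, Multiset.replicate (b i) (e i)) ↔ ∃ i, b i ≠ 0 ∧ e i = x) := by
  refine ⟨fun j => ?_, ?_, ?_, ?_⟩
  · rw [Multiset.count_sum']
    simp only [Multiset.count_replicate, he.eq_iff]
    simp
  · rw [Multiset.card_sum]
    simp
  · rw [Multiset.sum_sum]
    simp
  · intro x
    rw [Multiset.mem_sum]
    simp [Multiset.mem_replicate, eq_comm]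

theorem rep_of_le {m : ℕ} [NeZero m] (e : ZMod m → ℂ) (he : Function.Injective e)
    (a : ZMod m → ℕ) (T : Multiset ℂ) (hT : T ≤ ∑ i, Multiset.replicate (a i) (e i)) :
    T = ∑ i, Multiset.replicate (T.count (e i)) (e i) := by
  ext x
  by_cases hx : ∃ i, e i = x
  · obtain ⟨i, rfl⟩ := hx
    rw [(sum_replicate_facts e he (fun i => T.count (e i))).1 i]
  · have h1 : x ∉ T := fun h => by
      obtain ⟨i, _, hi⟩ := ((sum_replicate_facts e he a).2.2.2 x).1 (Multiset.mem_of_le hT h)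
      exact hx ⟨i, hi⟩
    have h2 : x ∉ ∑ i, Multiset.replicate (T.count (e i)) (e i) := fun h => by
      obtain ⟨i, _, hi⟩ := ((sum_replicate_facts e he _).2.2.2 x).1 h
      exact hx ⟨i, hi⟩
    rw [Multiset.count_eq_zero_of_notMem h1, Multiset.count_eq_zero_of_notMem h2]

theorem stmt_17 (m : ℕ) [NeZero m] (a : ZMod m → ℕ) (k : ℕ)
    (ha : IsMinimalVSum m a) (hk : HasReducedExponent m a k) :
    Squarefree k ∧ 2 + ∑ p ∈ k.primeFactors, (p - 2) ≤ ∑ i : ZMod m, a i := by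
  classical
  obtain ⟨⟨hk0, j, hj, hjk⟩, hleast⟩ := hk
  obtain ⟨⟨ha0, hasum⟩, hamin⟩ := ha
  have hm0 : m ≠ 0 := NeZero.ne m
  have hz : IsPrimitiveRoot (zetaC m) m := Complex.isPrimitiveRoot_exp m hm0
  have hz0 : zetaC m ≠ 0 := hz.ne_zero hm0
  let e : ZMod m → ℂ := fun i => zetaC m ^ i.val * (zetaC m ^ j.val)⁻¹
  have hej : e j = 1 := mul_inv_cancel₀ (pow_ne_zero _ hz0)
  have he : Function.Injective e := by
    intro i i' h
    have h1 := mul_right_cancel₀ (inv_ne_zero (pow_ne_zero _ hz0)) h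
    exact ZMod.val_injective m (hz.pow_inj (ZMod.val_lt i) (ZMod.val_lt i') h1)
  have hepow : ∀ (r : ℕ) (i : ZMod m), e i ^ r = 1 ↔ r • (i - j) = 0 := by
    intro r i
    have h1 : e i ^ r = 1 ↔ zetaC m ^ (i.val * r) = zetaC m ^ (j.val * r) := by
      simp only [e]
      rw [mul_pow, inv_pow, ← pow_mul, ← pow_mul, mul_inv_eq_one₀ (pow_ne_zero _ hz0)]
    have hfo : IsOfFinOrder (zetaC m) :=
      isOfFinOrder_iff_pow_eq_one.2 ⟨m, Nat.pos_of_ne_zero hm0, hz.pow_eq_one⟩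
    rw [h1, hfo.pow_eq_pow_iff_modEq, ← hz.eq_orderOf]
    rw [← ZMod.natCast_eq_natCast_iff]
    push_cast
    rw [ZMod.natCast_zmod_val, ZMod.natCast_zmod_val, nsmul_eq_mul, mul_sub, sub_eq_zero,
      mul_comm, mul_comm j]
  have hesum : ∀ b : ZMod m → ℕ, ∑ i, (b i : ℂ) * e i = 0 ↔
      ∑ i, (b i : ℂ) * zetaC m ^ i.val = 0 := by
    intro b
    simp only [e, ← mul_assoc]
    rw [← Finset.sum_mul, mul_eq_zero, or_iff_left (inv_ne_zero (pow_ne_zero _ hz0))]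
  obtain ⟨f1, f2, f3, f4⟩ := sum_replicate_facts e he a
  have hrep := rep_of_le e he a
  set S : Multiset ℂ := ∑ i, Multiset.replicate (a i) (e i) with hS
  have h1S : (1 : ℂ) ∈ S := (f4 1).2 ⟨j, hj, hej⟩
  have hS0 : S ≠ 0 := by
    intro h
    rw [h] at h1S
    simp at h1S
  have hsum : S.sum = 0 := by rw [f3, hesum, hasum]
  have hmin : MinV S := by
    intro T hT hT0 hTs
    have hTr := hrep T hT
    have h3 := (sum_replicate_facts e he (fun i => T.count (e i))).2.2.1
    rw [← hTr, hTs] at h3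
    have hb := hamin (fun i => T.count (e i))
      (fun i => by
        have := Multiset.count_le_of_le (e i) hT
        rwa [f1] at this)
      (by
        intro h
        apply hT0
        rw [hTr]
        refine Finset.sum_eq_zero (fun i _ => ?_)
        rw [show T.count (e i) = 0 from congrFun h i]
        simp) ((hesum _).1 h3.symm)
    rw [hTr, hS]
    exact Finset.sum_congr rfl (fun i _ => by rw [show T.count (e i) = a i from congrFun hb i])
  have hSk : ∀ x ∈ S, x ^ k = 1 := by
    intro x hx
    obtain ⟨i, hi, rfl⟩ := (f4 x).1 hx
    exact (hepow k i).2 (hjk i hi)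
  have hleast' : ∀ r, 0 < r → (∀ x ∈ S, x ^ r = 1) → k ≤ r := by
    intro r hr h
    exact hleast ⟨hr, j, hj, fun i hi => (hepow r i).1 (h _ ((f4 _).2 ⟨i, hi, rfl⟩))⟩
  have hsq : Squarefree k := by
    rw [Nat.squarefree_iff_prime_squarefree]
    rintro p hp ⟨r, hr⟩
    have hr0 : 0 < r := Nat.pos_of_ne_zero (by rintro rfl; omega)
    have hN0 : 0 < p * r := Nat.mul_pos hp.pos hr0
    have h1 := lemSq hp hN0 ⟨r, rfl⟩ S (by rw [← mul_assoc, ← hr]; exact hSk) hsum 1 (one_pow p)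
    have h2 := hmin _ (Multiset.filter_le _ S) (fun h0 => by
      have : (1 : ℂ) ∈ S.filter (fun z => z ^ (p * r) = 1) :=
        Multiset.mem_filter.2 ⟨h1S, one_pow _⟩
      rw [h0] at this
      simp at this) h1
    have h3 := hleast' (p * r) hN0 (Multiset.filter_eq_self.1 h2)
    rw [hr, mul_assoc] at h3
    have := hp.two_le
    nlinarith
  refine ⟨hsq, ?_⟩
  obtain ⟨n, hn, h2n, hkn, hgcd⟩ : ∃ n, Squarefree n ∧ 2 ∣ n ∧ k ∣ n ∧
      ∀ q ∈ k.primeFactors, q ≠ 2 → Nat.gcd (n / q) k = k / q := by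
    by_cases h2 : 2 ∣ k
    · refine ⟨k, hsq, h2, dvd_rfl, fun q hq _ => ?_⟩
      exact Nat.gcd_eq_left (Nat.div_dvd_of_dvd (Nat.dvd_of_mem_primeFactors hq))
    · refine ⟨2 * k, ?_, ⟨k, rfl⟩, ⟨2, mul_comm _ _⟩, fun q hq hq2 => ?_⟩
      · rw [Nat.squarefree_mul ((Nat.prime_two.coprime_iff_not_dvd).2 h2)]
        exact ⟨Nat.prime_two.prime.squarefree, hsq⟩
      · have hqP := Nat.prime_of_mem_primeFactors hq
        obtain ⟨r, rfl⟩ := Nat.dvd_of_mem_primeFactors hq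
        rw [mul_left_comm, Nat.mul_div_cancel_left _ hqP.pos, Nat.mul_div_cancel_left _ hqP.pos,
          Nat.gcd_mul_right, (Nat.coprime_primes Nat.prime_two hqP).2 (Ne.symm hq2), one_mul]
  have hSn : ∀ x ∈ S, x ^ n = 1 := by
    intro x hx
    obtain ⟨r, rfl⟩ := hkn
    rw [pow_mul, hSk x hx, one_pow]
  have hfin := min_bound hn h2n S hS0 hSn hsum hmin
  rw [f2] at hfin
  refine le_trans (Nat.add_le_add_left ?_ 2) hfin
  rw [← Finset.sum_filter_of_ne (p := fun q => q ≠ 2) (by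
    rintro q _ h rfl
    exact h rfl)]
  refine Finset.sum_le_sum_of_subset (fun q hq => ?_)
  obtain ⟨hqk, hq2⟩ := Finset.mem_filter.1 hq
  have hqP := Nat.prime_of_mem_primeFactors hqk
  have hqd := Nat.dvd_of_mem_primeFactors hqk
  refine mem_act.2 ⟨Nat.primeFactors_mono hkn hn.ne_zero hqk, hq2, ?_⟩
  by_contra hcon
  push Not at hcon
  have h3 := hleast' (k / q) (Nat.div_pos (Nat.le_of_dvd hk0 hqd) hqP.pos) (fun x hx => by
    have h4 := hcon x hx 1 h1S
    rw [one_pow] at h4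
    rw [← hgcd q hqk hq2]
    exact pow_gcd_eq_one.2 ⟨h4, hSk x hx⟩)
  exact absurd h3 (not_le.2 (Nat.div_lt_self hk0 hqP.one_lt))
end

section
/- Fix an integer m ≥ 1 and let ζ = exp(2πi/m). Let a : ZMod m → ℕ be a v-sum with c-exponent k. Then: (a) ∑_{i : ZMod m} a i ≥ 2 + ∑_{p prime, p ∣ k} (p − 2); (b) for each prime p dividing k there exists a function e_p : ZMod m → ℤ such that for every z ∈ ZMod m, (a z : ℤ) = ∑_{p prime, p ∣ k} ∑_{w ∈ ZMod m, p • w = 0} e_p (z − w). -/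
namespace CJ
open Finset

lemma galois {ι : Type*} (n : ℕ) (hn : 0 < n) (s : Finset ι) (c : ι → ℤ) (x : ι → ℂ)
    (hx : ∀ u ∈ s, x u ^ n = 1) (h : ∑ u ∈ s, (c u : ℂ) * x u = 0) (a : ℕ)
    (ha : Nat.Coprime a n) : ∑ u ∈ s, (c u : ℂ) * x u ^ a = 0 := by
  have : NeZero n := ⟨hn.ne'⟩
  have hζ := Complex.isPrimitiveRoot_exp n hn.ne'
  set ζ := Complex.exp (2 * Real.pi * Complex.I / n) with hζd
  have hex : ∀ u, ∃ i : ℕ, u ∈ s → ζ ^ i = x u := by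
    intro u
    by_cases hu : u ∈ s
    · obtain ⟨i, -, hi⟩ := hζ.eq_pow_of_pow_eq_one (hx u hu)
      exact ⟨i, fun _ => hi⟩
    · exact ⟨0, fun h => absurd h hu⟩
  choose i hi using hex
  let P : Polynomial ℤ := ∑ u ∈ s, Polynomial.C (c u) * Polynomial.X ^ (i u)
  have hev : ∀ z : ℂ, Polynomial.aeval z P = ∑ u ∈ s, (c u : ℂ) * z ^ (i u) := by
    intro z
    simp [P, map_sum]
  have h0 : Polynomial.aeval ζ P = 0 := by
    rw [hev, ← h]
    exact Finset.sum_congr rfl fun u hu => by rw [hi u hu]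
  have hd : minpoly ℤ ζ ∣ P := minpoly.isIntegrallyClosed_dvd (hζ.isIntegral hn) h0
  rw [hζ.minpoly_eq_pow_coprime ha] at hd
  have h1 : Polynomial.aeval (ζ ^ a) P = 0 := by
    obtain ⟨Q, hQ⟩ := hd
    rw [hQ, map_mul, minpoly.aeval, zero_mul]
  rw [hev] at h1
  rw [← h1]
  refine Finset.sum_congr rfl fun u hu => ?_
  rw [← hi u hu, ← pow_mul, ← pow_mul, mul_comm a]

lemma ortho (p : ℕ) (z w : ℂ) (hz : z ^ p = 1) (hw : w ^ p = 1) (hp : 0 < p) :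
    ∑ t ∈ range p, (w⁻¹) ^ t * z ^ t = if z = w then (p : ℂ) else 0 := by
  have hw0 : w ≠ 0 := by
    rintro rfl
    simp [hp.ne'] at hw
  simp_rw [← mul_pow]
  split_ifs with h
  · subst h
    simp [hw0]
  · have h1 : w⁻¹ * z ≠ 1 := by
      intro h2
      apply h
      field_simp at h2
      exact h2
    rw [geom_sum_eq h1, mul_pow, inv_pow, hz, hw]
    simp

lemma fourier {ι : Type*} (p : ℕ) (hp : 0 < p) (s : Finset ι) (d : ι → ℂ) (χ : ι → ℂ)
    (hχ : ∀ u ∈ s, χ u ^ p = 1) (γ : ℂ) (hγ : γ ^ p = 1) :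
    ∑ t ∈ range p, (γ⁻¹) ^ t * ∑ u ∈ s, d u * χ u ^ t
      = p * ∑ u ∈ s with χ u = γ, d u := by
  simp_rw [Finset.mul_sum]
  rw [Finset.sum_comm, Finset.sum_filter]
  refine Finset.sum_congr rfl fun u hu => ?_
  have := ortho p (χ u) γ (hχ u hu) hγ hp
  calc _ = d u * ∑ t ∈ range p, (γ⁻¹) ^ t * χ u ^ t := by
        rw [Finset.mul_sum]; exact Finset.sum_congr rfl fun t _ => by ring
    _ = _ := by rw [this]; split_ifs <;> ring

lemma lemB {ι : Type*} (p r : ℕ) (hp : p.Prime) (hr : 0 < r) (hpr : p ∣ r) (s : Finset ι)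
    (c : ι → ℤ) (x : ι → ℂ)
    (hx : ∀ u ∈ s, x u ^ (p * r) = 1) (h : ∑ u ∈ s, (c u : ℂ) * x u = 0) (γ : ℂ) :
    ∑ u ∈ s with x u ^ r = γ, (c u : ℂ) * x u = 0 := by
  by_cases hγ : γ ^ p = 1
  · have hF := fourier p hp.pos s (fun u => (c u : ℂ) * x u) (fun u => x u ^ r)
      (fun u hu => by rw [← pow_mul, mul_comm]; exact hx u hu) γ hγ
    have hz : ∀ t, ∑ u ∈ s, ((c u : ℂ) * x u) * (x u ^ r) ^ t = 0 := by
      intro t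
      have hc : Nat.Coprime (1 + r * t) (p * r) := by
        have h1 : Nat.Coprime (1 + r * t) r := by simp
        exact Nat.Coprime.mul_right (h1.coprime_dvd_right hpr) h1
      rw [← galois (p * r) (Nat.mul_pos hp.pos hr) s c x hx h _ hc]
      refine Finset.sum_congr rfl fun u hu => ?_
      rw [pow_add, pow_mul]; ring
    simp only [hz, mul_zero, Finset.sum_const_zero] at hF
    have hp0 : (p : ℂ) ≠ 0 := by exact_mod_cast hp.ne_zero
    exact (mul_eq_zero.mp hF.symm).resolve_left hp0
  · rw [Finset.filter_false_of_mem, Finset.sum_empty]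
    intro u hu hh
    apply hγ
    rw [← hh, ← pow_mul, mul_comm]; exact hx u hu

lemma lemA {ι : Type*} (p r : ℕ) (hp : p.Prime) (hr : 0 < r) (hpr : Nat.Coprime p r)
    (s : Finset ι) (c : ι → ℤ) (η y : ι → ℂ)
    (hη : ∀ u ∈ s, η u ^ p = 1) (hy : ∀ u ∈ s, y u ^ r = 1)
    (h : ∑ u ∈ s, (c u : ℂ) * (η u * y u) = 0) (γ : ℂ) (hγ : γ ^ p = 1) :
    p * ∑ u ∈ s with η u = γ, (c u : ℂ) * y u = ∑ u ∈ s, (c u : ℂ) * y u := by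
  rw [← fourier p hp.pos s (fun u => (c u : ℂ) * y u) η hη γ hγ]
  rw [Finset.sum_eq_single 0]
  · simp
  · intro t ht ht0
    have ht' := Finset.mem_range.mp ht
    obtain ⟨a, ha1, ha2⟩ := Nat.chineseRemainder hpr t 1
    have hcop : Nat.Coprime a (p * r) := by
      apply Nat.Coprime.mul_right
      · have : Nat.gcd a p = Nat.gcd t p := ha1.gcd_eq
        have h2 : Nat.Coprime t p := Nat.Coprime.symm
          ((Nat.Prime.coprime_iff_not_dvd hp).mpr
            (Nat.not_dvd_of_pos_of_lt (Nat.pos_of_ne_zero ht0) ht'))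
        exact this.trans h2
      · have : Nat.gcd a r = Nat.gcd 1 r := ha2.gcd_eq
        exact this.trans (by simp)
    have hg := galois (p * r) (Nat.mul_pos hp.pos hr) s c (fun u => η u * y u)
      (fun u hu => by
        rw [mul_pow, pow_mul, hη u hu, mul_comm p r, pow_mul, hy u hu]; simp) h a hcop
    have : ∑ u ∈ s, (c u : ℂ) * y u * η u ^ t = 0 := by
      rw [← hg]
      refine Finset.sum_congr rfl fun u hu => ?_
      rw [mul_pow, pow_eq_pow_of_modEq ha1 (hη u hu), pow_eq_pow_of_modEq ha2 (hy u hu)]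
      ring
    rw [this, mul_zero]
  · intro h0
    exact absurd (Finset.mem_range.mpr hp.pos) h0

lemma smul_modEq {G : Type*} [AddCommGroup G] {a b n : ℕ} (h : a ≡ b [MOD n]) {z : G} (hz : n • z = 0) :
    a • z = b • z := by
  have : ∀ c : ℕ, c • z = (c % n) • z := by
    intro c
    conv_lhs => rw [← Nat.mod_add_div c n, add_smul, mul_comm, mul_smul, hz, smul_zero, add_zero]
  rw [this a, this b, h]

def Rep (m : ℕ) [NeZero m] (S : Finset ℕ) (f : ZMod m → ℤ) : Prop :=
  ∃ E : ℕ → ZMod m → ℤ, ∀ z, f z = ∑ p ∈ S, ∑ w with p • w = 0, E p (z - w)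

section
variable {m : ℕ} [NeZero m]

lemma Rep.zero (S : Finset ℕ) : Rep m S (fun _ => 0) := ⟨fun _ _ => 0, fun z => by simp⟩

lemma Rep.sum {κ : Type*} {S : Finset ℕ} (A : Finset κ) (f : κ → ZMod m → ℤ)
    (h : ∀ k ∈ A, Rep m S (f k)) : Rep m S (fun z => ∑ k ∈ A, f k z) := by
  classical
  have : ∀ k, ∃ E : ℕ → ZMod m → ℤ, k ∈ A → ∀ z, f k z = ∑ p ∈ S, ∑ w with p • w = 0, E p (z - w) := by
    intro k
    by_cases hk : k ∈ A
    · obtain ⟨E, hE⟩ := h k hk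
      exact ⟨E, fun _ => hE⟩
    · exact ⟨0, fun h => absurd h hk⟩
  choose E hE using this
  refine ⟨fun p z => ∑ k ∈ A, E k p z, fun z => ?_⟩
  show ∑ k ∈ A, f k z = ∑ p ∈ S, ∑ w with p • w = 0, ∑ k ∈ A, E k p (z - w)
  rw [Finset.sum_congr rfl fun k hk => hE k hk z, Finset.sum_comm]
  refine Finset.sum_congr rfl fun p _ => ?_
  rw [Finset.sum_comm]

lemma Rep.add {S : Finset ℕ} {f g : ZMod m → ℤ} (hf : Rep m S f) (hg : Rep m S g) :
    Rep m S (fun z => f z + g z) := by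
  obtain ⟨E, hE⟩ := hf
  obtain ⟨F, hF⟩ := hg
  refine ⟨fun p z => E p z + F p z, fun z => ?_⟩
  simp only [hE, hF, Finset.sum_add_distrib]

lemma Rep.translate {S : Finset ℕ} {f : ZMod m → ℤ} (hf : Rep m S f) (j : ZMod m) :
    Rep m S (fun z => f (z - j)) := by
  obtain ⟨E, hE⟩ := hf
  refine ⟨fun p z => E p (z - j), fun z => ?_⟩
  simp only [hE]
  simp only [sub_right_comm]

lemma Rep.mono {S T : Finset ℕ} {f : ZMod m → ℤ} (hf : Rep m S f) (h : S ⊆ T) : Rep m T f := by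
  classical
  obtain ⟨E, hE⟩ := hf
  refine ⟨fun p z => if p ∈ S then E p z else 0, fun z => ?_⟩
  rw [hE, ← Finset.sum_subset h]
  · refine Finset.sum_congr rfl fun p hp => ?_
    simp [hp]
  · intro p _ hp
    simp [hp]

lemma Rep.single {S : Finset ℕ} {p : ℕ} (hp : p ∈ S) (F : ZMod m → ℤ) :
    Rep m S (fun z => ∑ w with p • w = 0, F (z - w)) := by
  classical
  have : Rep m {p} (fun z => ∑ w with p • w = 0, F (z - w)) := ⟨fun _ => F, fun z => by simp⟩
  exact this.mono (by simpa using hp)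

local notation "ee" => (ZMod.stdAddChar : AddChar (ZMod m) ℂ)

lemma ee_inj {a b : ZMod m} (h : ee a = ee b) : a = b := ZMod.injective_stdAddChar h

lemma sum_translate (f : ZMod m → ℤ) (j : ZMod m) (h : ∑ z, (f z : ℂ) * ee z = 0) :
    ∑ z, (f (z + j) : ℂ) * ee z = 0 := by
  rw [← Equiv.sum_comp (Equiv.addRight j)] at h
  simp only [Equiv.coe_addRight, AddChar.map_add_eq_mul, ← mul_assoc] at h
  rw [← Finset.sum_mul] at h
  refine (mul_eq_zero.mp h).resolve_right ?_
  intro h0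
  have := AddChar.map_add_eq_mul ee j (-j)
  rw [h0] at this
  simp at this

lemma rep_main (n : ℕ) : 0 < n → ∀ f : ZMod m → ℤ, (∀ z, f z ≠ 0 → n • z = 0) →
    ∑ z, (f z : ℂ) * ee z = 0 → Rep m n.primeFactors f := by
  induction n using Nat.strong_induction_on with
  | _ n ih =>
  intro hn f hf hs
  by_cases h1 : n = 1
  · subst h1
    have : f = fun _ => 0 := by
      funext z
      by_contra hz
      have hz0 := hf z hz
      rw [one_smul] at hz0
      subst hz0
      rw [Finset.sum_eq_single 0] at hs
      · simp at hs; exact hz hs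
      · intro b _ hb
        have : f b = 0 := by
          by_contra hb'
          exact hb (by simpa using hf b hb')
        simp [this]
      · simp
    rw [this]
    exact Rep.zero _
  obtain ⟨p, hp, r, rfl⟩ := Nat.exists_prime_and_dvd h1
  have hr : 0 < r := Nat.pos_of_mul_pos_left hn
  have hrn : r < p * r := by nlinarith [hp.two_le]
  have hsub : r.primeFactors ⊆ (p * r).primeFactors :=
    Nat.primeFactors_mono (Dvd.intro_left p rfl) hn.ne'
  have hss : ∑ z with (p * r) • z = 0, (f z : ℂ) * ee z = 0 := by
    rw [← hs, Finset.sum_filter]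
    refine Finset.sum_congr rfl fun z _ => ?_
    split_ifs with h
    · rfl
    · have : f z = 0 := by
        by_contra h'
        exact h (hf z h')
      simp [this]
  have hpow : ∀ (a : ℕ) (z : ZMod m), ee z ^ a = ee (a • z) := fun a z =>
    (AddChar.map_nsmul_eq_pow _ a z).symm
  by_cases hpr : p ∣ r
  · have key : f = fun z => ∑ γ : ZMod m, if r • z = γ then f z else 0 := by
      funext z
      simp
    rw [key]
    refine Rep.sum _ (fun γ z => if r • z = γ then f z else 0) fun γ _ => ?_
    by_cases hj : ∃ j, f j ≠ 0 ∧ r • j = γ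
    · obtain ⟨j, hj0, rfl⟩ := hj
      have hB := lemB p r hp hr hpr _ f (fun z => ee z) (fun z hz => by
        rw [hpow, (Finset.mem_filter.mp hz).2]; simp) hss (ee j ^ r)
      have h2 : ∑ z, ((if r • z = r • j then f z else 0 : ℤ) : ℂ) * ee z = 0 := by
        rw [← hB, Finset.filter_filter, Finset.sum_filter]
        refine Finset.sum_congr rfl fun z _ => ?_
        rw [hpow, hpow]
        by_cases hz : f z = 0
        · simp [hz]
        · have := hf z hz
          by_cases h3 : r • z = r • j
          · rw [if_pos h3, if_pos ⟨this, by rw [h3]⟩]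
          · rw [if_neg h3, if_neg (fun h4 => h3 (ee_inj h4.2))]
            simp
      have h3 := sum_translate (fun z => if r • z = r • j then f z else 0) j h2
      have h4 := ih r hrn hr (fun z => if r • (z + j) = r • j then f (z + j) else 0)
        (fun z hz => by
          by_contra h5
          apply hz
          rw [if_neg]
          rw [smul_add]
          simpa using h5) h3
      have h5 := (h4.mono hsub).translate j
      simpa using h5
    · have : (fun z => if r • z = γ then f z else 0) = fun _ => 0 := by
        funext z
        split_ifs with h
        · by_contra h'
          exact hj ⟨z, h', h⟩
        · rfl
      rw [this]
      exact Rep.zero _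
  · have hcop : Nat.Coprime p r := (Nat.Prime.coprime_iff_not_dvd hp).mpr hpr
    obtain ⟨α, hα1, hα2⟩ := Nat.chineseRemainder hcop 1 0
    obtain ⟨β, hβ1, hβ2⟩ := Nat.chineseRemainder hcop 0 1
    have hαβ : α + β ≡ 1 [MOD p * r] := by
      rw [← Nat.modEq_and_modEq_iff_modEq_mul hcop]
      exact ⟨hα1.add hβ1, hα2.add hβ2⟩
    have pα : ∀ z : ZMod m, (p * r) • z = 0 → p • (α • z) = 0 := by
      intro z hz
      obtain ⟨k, rfl⟩ := (Nat.modEq_zero_iff_dvd.mp hα2)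
      rw [← mul_smul, ← mul_assoc, mul_comm, mul_smul, hz, smul_zero]
    have rβ : ∀ z : ZMod m, (p * r) • z = 0 → r • (β • z) = 0 := by
      intro z hz
      obtain ⟨k, rfl⟩ := (Nat.modEq_zero_iff_dvd.mp hβ1)
      rw [← mul_smul, show r * (p * k) = k * (p * r) by ring, mul_smul, hz, smul_zero]
    have hsplit : ∀ z : ZMod m, (p * r) • z = 0 → α • z + β • z = z := by
      intro z hz
      rw [← add_smul, smul_modEq hαβ hz, one_smul]
    let F : ZMod m → ZMod m → ℤ := fun h y => if r • y = 0 then f (h + y) else 0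
    have hF : ∀ h : ZMod m, p • h = 0 → (p : ℂ) * ∑ y, (F h y : ℂ) * ee y =
        ∑ z with (p * r) • z = 0, (f z : ℂ) * ee (β • z) := by
      intro h hh
      rw [← lemA p r hp hr hcop _ f (fun z => ee (α • z)) (fun z => ee (β • z))
        (fun z hz => by
          rw [hpow, pα z (Finset.mem_filter.mp hz).2]; simp)
        (fun z hz => by
          rw [hpow, rβ z (Finset.mem_filter.mp hz).2]; simp)
        (by
          rw [← hss]
          refine Finset.sum_congr rfl fun z hz => ?_
          rw [← AddChar.map_add_eq_mul, hsplit z (Finset.mem_filter.mp hz).2])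
        (ee h) (by rw [hpow, hh]; simp)]
      congr 1
      have e1 : ∑ y, (F h y : ℂ) * ee y = ∑ y with r • y = 0, (f (h + y) : ℂ) * ee y := by
        rw [Finset.sum_filter]
        refine Finset.sum_congr rfl fun y _ => ?_
        simp only [F]
        split_ifs <;> simp
      rw [e1]
      symm
      refine Finset.sum_nbij' (fun z => β • z) (fun y => h + y) ?_ ?_ ?_ ?_ ?_
      · intro z hz
        simp only [Finset.mem_filter, Finset.mem_univ, true_and] at hz ⊢
        exact rβ z hz.1
      · intro y hy
        simp only [Finset.mem_filter, Finset.mem_univ, true_and] at hy ⊢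
        refine ⟨?_, ?_⟩
        · rw [smul_add, mul_comm, mul_smul, hh, mul_comm, mul_smul, hy]; simp
        · rw [smul_add, smul_modEq hα1 hh, smul_modEq hα2 hy]; simp
      · intro z hz
        simp only [Finset.mem_filter, Finset.mem_univ, true_and] at hz
        have := ee_inj hz.2
        conv_rhs => rw [← hsplit z hz.1, this]
      · intro y hy
        simp only [Finset.mem_filter, Finset.mem_univ, true_and] at hy
        rw [smul_add, smul_modEq hβ1 hh, smul_modEq hβ2 hy]; simp
      · intro z hz
        simp only [Finset.mem_filter, Finset.mem_univ, true_and] at hz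
        have := ee_inj hz.2
        rw [← this, hsplit z hz.1]
    have hp0 : (p : ℂ) ≠ 0 := by exact_mod_cast hp.ne_zero
    have hFeq : ∀ h : ZMod m, p • h = 0 → ∑ y, (F h y : ℂ) * ee y = ∑ y, (F 0 y : ℂ) * ee y := by
      intro h hh
      apply mul_left_cancel₀ hp0
      rw [hF h hh, hF 0 (by simp)]
    have hg : ∀ h : ZMod m, p • h = 0 → Rep m r.primeFactors (fun z => F h z - F 0 z) := by
      intro h hh
      refine ih r hrn hr _ ?_ ?_
      · intro z hz
        by_contra h'
        apply hz
        simp only [F]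
        rw [if_neg h', if_neg h', sub_zero]
      · push_cast
        simp only [sub_mul, Finset.sum_sub_distrib]
        rw [hFeq h hh, sub_self]
    have hfz : f = fun z => (∑ h with p • h = 0, (F h (z - h) - F 0 (z - h))) +
        ∑ w with p • w = 0, F 0 (z - w) := by
      funext z
      rw [← Finset.sum_add_distrib]
      simp only [sub_add_cancel]
      simp only [F, add_sub_cancel]
      by_cases hz : f z = 0
      · simp [hz]
      · have hz' := hf z hz
        rw [Finset.sum_eq_single (α • z)]
        · rw [if_pos]
          have h7 : z - α • z = β • z := by
            rw [sub_eq_iff_eq_add, add_comm]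
            exact (hsplit z hz').symm
          rw [h7, rβ z hz']
        · intro h hh hne
          rw [if_neg]
          intro h2
          apply hne
          have hh' : p • h = 0 := (Finset.mem_filter.mp hh).2
          have h3 : α • (z - h) = 0 := by rw [smul_modEq hα2 h2, zero_smul]
          rw [smul_sub, smul_modEq hα1 hh', one_smul, sub_eq_zero] at h3
          exact h3.symm
        · intro h
          exact absurd (by simpa only [Finset.mem_filter, Finset.mem_univ, true_and] using pα z hz') h
    rw [hfz]
    refine Rep.add ?_ (Rep.single (Nat.mem_primeFactors.mpr ⟨hp, Dvd.intro r rfl, hn.ne'⟩) _)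
    refine Rep.sum _ (fun h z => F h (z - h) - F 0 (z - h)) fun h hh => ?_
    exact ((hg h (Finset.mem_filter.mp hh).2).mono hsub).translate h

end

section
variable {ι : Type*} [DecidableEq ι]

def Mn (s : Finset ι) (x : ι → ℂ) : Prop :=
  s.Nonempty ∧ ∑ u ∈ s, x u = 0 ∧ ∀ t ⊆ s, t.Nonempty → ∑ u ∈ t, x u = 0 → t = s

lemma exists_mn (s : Finset ι) (x : ι → ℂ) (hs : s.Nonempty) (h : ∑ u ∈ s, x u = 0) :
    ∃ t ⊆ s, Mn t x := by
  induction s using Finset.strongInduction with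
  | _ s ih =>
  by_cases hm : Mn s x
  · exact ⟨s, Subset.rfl, hm⟩
  · have : ∃ t ⊆ s, t.Nonempty ∧ ∑ u ∈ t, x u = 0 ∧ t ≠ s := by
      by_contra! hc
      exact hm ⟨hs, h, fun t ht hn h0 => hc t ht hn h0⟩
    obtain ⟨t, hts, htn, ht0, hne⟩ := this
    obtain ⟨t', h1, h2⟩ := ih t (hts.ssubset_of_ne hne) htn ht0
    exact ⟨t', h1.trans hts, h2⟩

/-- `n` is the reduced exponent of the family. -/
def Rd (s : Finset ι) (x : ι → ℂ) (n : ℕ) : Prop :=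
  (∀ u ∈ s, ∀ v ∈ s, x u ^ n = x v ^ n) ∧
    ∀ p : ℕ, p.Prime → p ∣ n → ∃ u ∈ s, ∃ v ∈ s, x u ^ (n / p) ≠ x v ^ (n / p)

lemma exists_rd (s : Finset ι) (x : ι → ℂ) (N : ℕ) (hN : 0 < N) (h : ∀ u ∈ s, x u ^ N = 1) :
    ∃ e, e ∣ N ∧ Rd s x e := by
  classical
  have hex : ∃ e, 0 < e ∧ e ∣ N ∧ ∀ u ∈ s, ∀ v ∈ s, x u ^ e = x v ^ e :=
    ⟨N, hN, dvd_rfl, fun u hu v hv => by rw [h u hu, h v hv]⟩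
  obtain ⟨h1, h2, h3⟩ := Nat.find_spec hex
  refine ⟨Nat.find hex, h2, h3, fun p hp hpe => ?_⟩
  by_contra! hc
  exact Nat.find_min hex (Nat.div_lt_self h1 hp.one_lt)
    ⟨Nat.div_pos (Nat.le_of_dvd h1 hpe) hp.pos, (Nat.div_dvd_of_dvd hpe).trans h2, hc⟩

lemma general (n : ℕ)
    (IH : ∀ e < n, 0 < e → ∀ (s : Finset ι) (x : ι → ℂ), (∀ u ∈ s, x u ≠ 0) → Mn s x → Rd s x e →
      2 + ∑ p ∈ e.primeFactors, (p - 2) ≤ s.card)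
    (N : ℕ) (hN : 0 < N) (hNn : N < n) (x : ι → ℂ) (s : Finset ι)
    (hx : ∀ u ∈ s, x u ^ N = 1) (h0 : ∑ u ∈ s, x u = 0) :
    ∃ Q : Finset ℕ, (2 + ∑ p ∈ Q, (p - 2) ≤ s.card ∨ (s = ∅ ∧ Q = ∅)) ∧
      ∀ q : ℕ, q.Prime → q ∉ Q → q ∣ N → ¬ q * q ∣ N → ∀ γ : ℂ,
        ∑ u ∈ s with x u ^ (N / q) = γ, x u = 0 := by
  induction s using Finset.strongInduction with
  | _ s ih =>
  by_cases hs : s = ∅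
  · subst hs
    exact ⟨∅, Or.inr ⟨rfl, rfl⟩, by simp⟩
  obtain ⟨t, hts, ht⟩ := exists_mn s x (Finset.nonempty_iff_ne_empty.mpr hs) h0
  obtain ⟨e, heN, he⟩ := exists_rd t x N hN (fun u hu => hx u (hts hu))
  have he0 : 0 < e := Nat.pos_of_dvd_of_pos heN hN
  have hb := IH e ((Nat.le_of_dvd hN heN).trans_lt hNn) he0 t x
    (fun u hu h => by
      have := hx u (hts hu)
      rw [h, zero_pow hN.ne'] at this
      exact zero_ne_one this) ht he
  have hsum := Finset.sum_sdiff (f := x) hts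
  rw [ht.2.1, h0, add_zero] at hsum
  obtain ⟨Q, hQ1, hQ2⟩ := ih (s \ t) (Finset.sdiff_ssubset hts ht.1)
    (fun u hu => hx u (Finset.mem_sdiff.mp hu).1) hsum
  have hcard := Finset.card_sdiff_add_card_eq_card hts
  refine ⟨Q ∪ e.primeFactors, Or.inl ?_, ?_⟩
  · have h1 : ∑ p ∈ Q ∪ e.primeFactors, (p - 2) ≤ ∑ p ∈ Q, (p - 2) + ∑ p ∈ e.primeFactors, (p - 2) := by
      rw [← Finset.sum_union_inter]
      exact Nat.le_add_right _ _
    have h2 : ∑ p ∈ Q, (p - 2) ≤ (s \ t).card := by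
      rcases hQ1 with h | ⟨_, rfl⟩
      · omega
      · simp
    omega
  · intro q hq hqQ hqN hqq γ
    rw [Finset.mem_union, not_or] at hqQ
    have h1 := hQ2 q hq hqQ.1 hqN hqq γ
    have hqe : ¬ q ∣ e := fun h => hqQ.2 (Nat.mem_primeFactors.mpr ⟨hq, h, he0.ne'⟩)
    have hed : e ∣ N / q := by
      obtain ⟨k, rfl⟩ := hqN
      rw [Nat.mul_div_cancel_left _ hq.pos]
      exact (Nat.Coprime.symm ((Nat.Prime.coprime_iff_not_dvd hq).mpr hqe)).dvd_of_dvd_mul_left heN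
    have h2 : ∑ u ∈ t with x u ^ (N / q) = γ, x u = 0 := by
      obtain ⟨u0, hu0⟩ := ht.1
      have hc : ∀ u ∈ t, x u ^ (N / q) = x u0 ^ (N / q) := by
        intro u hu
        obtain ⟨k, hk⟩ := hed
        rw [hk, pow_mul, pow_mul, he.1 u hu u0 hu0]
      by_cases hγ : x u0 ^ (N / q) = γ
      · rw [Finset.filter_true_of_mem (fun u hu => (hc u hu).trans hγ)]
        exact ht.2.1
      · rw [Finset.filter_false_of_mem (fun u hu h => hγ ((hc u hu).symm.trans h))]
        simp
    rw [Finset.sum_filter] at h1 h2 ⊢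
    rw [← Finset.sum_sdiff hts, h1, h2, add_zero]

lemma card_odd_primes (T : Finset ℕ) (p : ℕ) (h : ∀ q ∈ T, Odd q ∧ 3 ≤ q ∧ q < p) (hp : Odd p) :
    2 * T.card + 1 ≤ p := by
  obtain ⟨k, rfl⟩ := hp
  have : T.card ≤ (Finset.range k).card := by
    apply Finset.card_le_card_of_injOn (fun q => q / 2)
    · intro q hq
      obtain ⟨⟨j, rfl⟩, h2, h3⟩ := h q hq
      simp; omega
    · intro a ha b hb hab
      obtain ⟨⟨i, rfl⟩, _⟩ := h a ha
      obtain ⟨⟨j, rfl⟩, _⟩ := h b hb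
      simp at hab
      omega
  simp at this
  omega

lemma arith {κ : Type*} [DecidableEq κ] (G : Finset κ) (g0 : κ) (hg0 : g0 ∈ G) (w : κ → ℕ)
    (hw1 : 1 ≤ w g0) (hmin : ∀ g ∈ G, w g0 ≤ w g) (T : Finset ℕ) (hT : 2 * T.card + 1 ≤ G.card)
    (i : ℕ → κ) (hi : ∀ q ∈ T, i q ∈ G.erase g0)
    (hb : ∀ g ∈ G.erase g0, 2 + ∑ q ∈ T with i q = g, (q - 2) ≤ w g + w g0) :
    G.card + ∑ q ∈ T, (q - 2) ≤ ∑ g ∈ G, w g := by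
  set I := T.image i with hI
  have hIc : I.card ≤ T.card := Finset.card_image_le
  have hIG : I ⊆ G.erase g0 := by
    intro g hg
    obtain ⟨q, hq, rfl⟩ := Finset.mem_image.mp hg
    exact hi q hq
  have hfib : ∑ q ∈ T, (q - 2) = ∑ g ∈ I, ∑ q ∈ T with i q = g, (q - 2) :=
    (Finset.sum_fiberwise_of_maps_to (fun q hq => Finset.mem_image_of_mem i hq) _).symm
  have h1 : I.card * 2 + ∑ q ∈ T, (q - 2) ≤ ∑ g ∈ I, w g + I.card * w g0 := by
    rw [hfib, ← smul_eq_mul, ← smul_eq_mul, ← Finset.sum_const, ← Finset.sum_const,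
      ← Finset.sum_add_distrib, ← Finset.sum_add_distrib]
    exact Finset.sum_le_sum fun g hg => hb g (hIG hg)
  have h2 : (G.erase g0 \ I).card * w g0 ≤ ∑ g ∈ G.erase g0 \ I, w g := by
    rw [← smul_eq_mul, ← Finset.sum_const]
    exact Finset.sum_le_sum fun g hg =>
      hmin g (Finset.mem_of_mem_erase (Finset.mem_sdiff.mp hg).1)
  have h3 := Finset.sum_sdiff (f := w) hIG
  have h4 := Finset.add_sum_erase G w hg0
  have h5 := Finset.card_sdiff_add_card_eq_card hIG
  have h6 := Finset.card_erase_add_one hg0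
  obtain ⟨d, hd⟩ : ∃ d, (G.erase g0 \ I).card = I.card + d := ⟨_, (Nat.add_sub_of_le (by omega)).symm⟩
  obtain ⟨μ, hμ⟩ : ∃ μ, w g0 = μ + 1 := ⟨_, (Nat.sub_add_cancel hw1).symm⟩
  rw [hd, hμ] at h2
  rw [hμ] at h1 h4
  nlinarith [Nat.zero_le (d * μ)]

lemma exists_roots (p : ℕ) (hp : 1 < p) : ∃ Γ : Finset ℂ, Γ.card = p ∧ (∀ γ, γ ∈ Γ ↔ γ ^ p = 1) ∧
    ∑ γ ∈ Γ, γ = 0 := by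
  have hζ := Complex.isPrimitiveRoot_exp p (by omega)
  set ζ := Complex.exp (2 * Real.pi * Complex.I / p)
  have : NeZero p := ⟨by omega⟩
  have hinj : Set.InjOn (fun i => ζ ^ i) (range p : Finset ℕ) := by
    intro a ha b hb hab
    exact hζ.pow_inj (by simpa using ha) (by simpa using hb) hab
  refine ⟨(range p).image (fun i => ζ ^ i), ?_, ?_, ?_⟩
  · rw [Finset.card_image_of_injOn hinj, Finset.card_range]
  · intro γ
    constructor
    · intro h
      obtain ⟨i, _, rfl⟩ := Finset.mem_image.mp h
      rw [← pow_mul, mul_comm, pow_mul, hζ.pow_eq_one, one_pow]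
    · intro h
      obtain ⟨i, hi, rfl⟩ := hζ.eq_pow_of_pow_eq_one h
      exact Finset.mem_image.mpr ⟨i, by simpa using hi, rfl⟩
  · rw [Finset.sum_image hinj]
    exact hζ.geom_sum_eq_zero hp

lemma two_le (s : Finset ι) (x : ι → ℂ) (hx : ∀ u ∈ s, x u ≠ 0) (hm : Mn s x) : 2 ≤ s.card := by
  have h1 := hm.1.card_pos
  by_contra h
  obtain ⟨u, hu⟩ := Finset.card_eq_one.mp (show s.card = 1 by omega)
  have := hm.2.1
  rw [hu, Finset.sum_singleton] at this
  exact hx u (by simp [hu]) this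

lemma step (n : ℕ) (hn : 0 < n)
    (IH : ∀ e < n, 0 < e → ∀ (s : Finset ι) (x : ι → ℂ), (∀ u ∈ s, x u ≠ 0) → Mn s x → Rd s x e →
      2 + ∑ p ∈ e.primeFactors, (p - 2) ≤ s.card)
    (s : Finset ι) (x : ι → ℂ) (hx : ∀ u ∈ s, x u ^ n = 1) (hm : Mn s x)
    (hrd : ∀ p : ℕ, p.Prime → p ∣ n → ∃ u ∈ s, ∃ v ∈ s, x u ^ (n / p) ≠ x v ^ (n / p)) :
    2 + ∑ p ∈ n.primeFactors, (p - 2) ≤ s.card := by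
  classical
  have hx0 : ∀ u ∈ s, x u ≠ 0 := fun u hu h => by
    have := hx u hu
    rw [h, zero_pow hn.ne'] at this
    exact zero_ne_one this
  -- a class function with vanishing class sums is constant
  have hconst : ∀ c : ι → ℂ, (∀ δ, ∑ u ∈ s with c u = δ, x u = 0) → ∀ u ∈ s, ∀ v ∈ s, c u = c v := by
    intro c hc u hu v hv
    have := hm.2.2 (s.filter fun w => c w = c v) (Finset.filter_subset _ _)
      ⟨v, Finset.mem_filter.mpr ⟨hv, rfl⟩⟩ (hc _)
    rw [← this] at hu
    exact (Finset.mem_filter.mp hu).2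
  -- squarefree
  have hsq : ∀ p : ℕ, p.Prime → ¬ p * p ∣ n := by
    intro p hp hpp
    obtain ⟨k, rfl⟩ := hpp
    obtain ⟨u, hu, v, hv, huv⟩ := hrd p hp ⟨p * k, by ring⟩
    apply huv
    have he : p * p * k / p = p * k := by
      rw [mul_assoc, Nat.mul_div_cancel_left _ hp.pos]
    rw [he]
    refine hconst (fun w => x w ^ (p * k)) (fun δ => ?_) u hu v hv
    have := lemB p (p * k) hp (Nat.pos_of_ne_zero (by rintro h; simp [mul_assoc, h] at hn))
      ⟨k, rfl⟩ s (fun _ => 1) x (fun u hu => by rw [← mul_assoc]; exact hx u hu)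
      (by simpa using hm.2.1) δ
    simpa using this
  by_cases hodd : ∀ p ∈ n.primeFactors, p = 2
  · rw [Finset.sum_eq_zero (fun p hp => by simp [hodd p hp])]
    exact two_le s x hx0 hm
  push Not at hodd
  obtain ⟨p', hp', hp'2⟩ := hodd
  obtain ⟨p, hpn, hpmax⟩ := Finset.exists_max_image n.primeFactors id ⟨p', hp'⟩
  simp only [id] at hpmax
  have hp : p.Prime := Nat.prime_of_mem_primeFactors hpn
  have hp3 : 3 ≤ p := by
    have h1 := (Nat.prime_of_mem_primeFactors hp').two_le
    have h2 := hpmax p' hp'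
    omega
  have hpodd : Odd p := hp.odd_of_ne_two (by omega)
  obtain ⟨r, rfl⟩ := Nat.dvd_of_mem_primeFactors hpn
  have hr : 0 < r := Nat.pos_of_mul_pos_left hn
  have hcop : Nat.Coprime p r := (Nat.Prime.coprime_iff_not_dvd hp).mpr fun h =>
    hsq p hp (Nat.mul_dvd_mul_left p h)
  obtain ⟨α, hα1, hα2⟩ := Nat.chineseRemainder hcop 1 0
  obtain ⟨β, hβ1, hβ2⟩ := Nat.chineseRemainder hcop 0 1
  have hαβ : α + β ≡ 1 [MOD p * r] := by
    rw [← Nat.modEq_and_modEq_iff_modEq_mul hcop]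
    exact ⟨hα1.add hβ1, hα2.add hβ2⟩
  set η : ι → ℂ := fun u => x u ^ α with hηd
  set y : ι → ℂ := fun u => x u ^ β with hyd
  have hxy : ∀ u ∈ s, η u * y u = x u := by
    intro u hu
    simp only [hηd, hyd]
    rw [← pow_add, pow_eq_pow_of_modEq hαβ (hx u hu), pow_one]
  have hη : ∀ u ∈ s, η u ^ p = 1 := by
    intro u hu
    obtain ⟨k, hk⟩ := Nat.modEq_zero_iff_dvd.mp hα2
    simp only [hηd]
    rw [← pow_mul, hk, show r * k * p = p * r * k by ring, pow_mul, hx u hu, one_pow]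
  have hy : ∀ u ∈ s, y u ^ r = 1 := by
    intro u hu
    obtain ⟨k, hk⟩ := Nat.modEq_zero_iff_dvd.mp hβ1
    simp only [hyd]
    rw [← pow_mul, hk, show p * k * r = p * r * k by ring, pow_mul, hx u hu, one_pow]
  obtain ⟨Γ, hΓc, hΓ, hΓ0⟩ := exists_roots p (by omega)
  have hηΓ : ∀ u ∈ s, η u ∈ Γ := fun u hu => (hΓ _).mpr (hη u hu)
  let A : ℂ → Finset ι := fun γ => s.filter fun u => η u = γ
  have hAs : ∀ γ, A γ ⊆ s := fun γ => Finset.filter_subset _ _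
  have hAη : ∀ γ, ∀ u ∈ A γ, η u = γ := fun γ u hu => (Finset.mem_filter.mp hu).2
  have hp0 : (p : ℂ) ≠ 0 := by exact_mod_cast hp.ne_zero
  obtain ⟨C, hC⟩ : ∃ C : ℂ, ∀ γ ∈ Γ, ∑ u ∈ A γ, y u = C := by
    refine ⟨(∑ u ∈ s, y u) / p, fun γ hγ => ?_⟩
    have := lemA p r hp hr hcop s (fun _ => 1) η y hη hy
      (by
        rw [← hm.2.1]
        exact Finset.sum_congr rfl fun u hu => by rw [hxy u hu]; simp) γ ((hΓ γ).mp hγ)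
    simp only [Int.cast_one, one_mul] at this
    rw [eq_div_iff hp0, mul_comm]
    exact this
  have hxA : ∀ γ, ∀ t ⊆ A γ, ∑ u ∈ t, x u = γ * ∑ u ∈ t, y u := by
    intro γ t ht
    rw [Finset.mul_sum]
    refine Finset.sum_congr rfl fun u hu => ?_
    rw [← hxy u (hAs γ (ht hu)), hAη γ u (ht hu)]
  have hC0 : C ≠ 0 := by
    intro h0
    obtain ⟨u, hu, v, hv, huv⟩ := hrd p hp ⟨r, rfl⟩
    apply huv
    rw [Nat.mul_div_cancel_left _ hp.pos]
    have : η u = η v := by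
      refine hconst η (fun δ => ?_) u hu v hv
      by_cases hδ : δ ∈ Γ
      · rw [show (s.filter fun u => η u = δ) = A δ from rfl, hxA δ _ Subset.rfl, hC δ hδ, h0, mul_zero]
      · rw [Finset.filter_false_of_mem, Finset.sum_empty]
        intro w hw h
        exact hδ (h ▸ hηΓ w hw)
    rw [← hxy u hu, ← hxy v hv, mul_pow, mul_pow, hy u hu, hy v hv, this]
  obtain ⟨γ0, hγ0, hγmin⟩ := Finset.exists_min_image Γ (fun γ => (A γ).card)
    (Finset.card_pos.mp (by omega))
  have hAne : ∀ γ ∈ Γ, 1 ≤ (A γ).card := by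
    intro γ hγ
    rw [Nat.one_le_iff_ne_zero, Ne, Finset.card_eq_zero]
    intro h
    have := hC γ hγ
    rw [h, Finset.sum_empty] at this
    exact hC0 this.symm
  have hdisj : ∀ γ ∈ Γ.erase γ0, Disjoint (A γ) (A γ0) := by
    intro γ hγ
    rw [Finset.disjoint_left]
    intro u h1 h2
    exact Finset.ne_of_mem_erase hγ ((hAη _ u h1).symm.trans (hAη _ u h2))
  -- signed family
  let x' : ι → ℂ := fun u => if η u = γ0 then - y u else y u
  have hx'0 : ∀ t ⊆ A γ0, ∑ u ∈ t, x' u = - ∑ u ∈ t, y u := by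
    intro t ht
    rw [← Finset.sum_neg_distrib]
    exact Finset.sum_congr rfl fun u hu => by simp only [x']; rw [if_pos (hAη _ u (ht hu))]
  have hx'1 : ∀ γ ∈ Γ.erase γ0, ∀ t ⊆ A γ, ∑ u ∈ t, x' u = ∑ u ∈ t, y u := by
    intro γ hγ t ht
    refine Finset.sum_congr rfl fun u hu => ?_
    simp only [x']
    rw [if_neg]
    rw [hAη _ u (ht hu)]
    exact Finset.ne_of_mem_erase hγ
  have hx'p : ∀ u, ∀ k, x' u ^ (2 * k) = y u ^ (2 * k) := by
    intro u k
    simp only [x']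
    split_ifs
    · rw [pow_mul, pow_mul, neg_sq]
    · rfl
  have hgen : ∀ γ, ∃ Q : Finset ℕ, γ ∈ Γ.erase γ0 →
      (2 + ∑ q ∈ Q, (q - 2) ≤ (A γ).card + (A γ0).card) ∧
      ∀ q : ℕ, q.Prime → q ∉ Q → q ∣ 2 * r → ¬ q * q ∣ 2 * r → ∀ δ : ℂ,
        ∑ u ∈ A γ ∪ A γ0 with x' u ^ (2 * r / q) = δ, x' u = 0 := by
    intro γ
    by_cases hγ : γ ∈ Γ.erase γ0
    · obtain ⟨Q, h1, h2⟩ := general (p * r) IH (2 * r) (by omega) (by nlinarith) x' (A γ ∪ A γ0)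
        (fun u hu => by
          rw [hx'p, mul_comm, pow_mul, hy u (Finset.union_subset (hAs γ) (hAs γ0) hu), one_pow])
        (by
          rw [Finset.sum_union (hdisj γ hγ), hx'1 γ hγ _ Subset.rfl, hx'0 _ Subset.rfl,
            hC γ (Finset.mem_of_mem_erase hγ), hC γ0 hγ0, add_neg_cancel])
      refine ⟨Q, fun _ => ⟨?_, h2⟩⟩
      rw [Finset.card_union_of_disjoint (hdisj γ hγ)] at h1
      rcases h1 with h1 | ⟨h1, _⟩
      · exact h1
      · exfalso
        have := hAne γ0 hγ0
        rw [Finset.union_eq_empty] at h1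
        rw [h1.2] at this
        simp at this
    · exact ⟨∅, fun h => absurd h hγ⟩
  choose Q hQ using hgen
  set T := (((p * r).primeFactors).erase p).erase 2 with hT
  have hTp : ∀ q ∈ T, q.Prime ∧ q ≠ 2 ∧ q ≠ p ∧ q ∣ p * r := by
    intro q hq
    simp only [hT, Finset.mem_erase] at hq
    exact ⟨Nat.prime_of_mem_primeFactors hq.2.2, hq.1, hq.2.1, Nat.dvd_of_mem_primeFactors hq.2.2⟩
  have hcover : ∀ q, ∃ γ, q ∈ T → γ ∈ Γ.erase γ0 ∧ q ∈ Q γ := by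
    intro q
    by_cases hqT : q ∈ T
    swap
    · exact ⟨0, fun h => absurd h hqT⟩
    by_contra! hno
    obtain ⟨hq, hq2, hqp, hqn⟩ := hTp q hqT
    have hno' : ∀ γ ∈ Γ.erase γ0, q ∉ Q γ := fun γ hγ => (hno γ).2 hγ
    have hqr : q ∣ r := by
      rcases (Nat.Prime.dvd_mul hq).mp hqn with h | h
      · exact absurd ((Nat.prime_dvd_prime_iff_eq hq hp).mp h) hqp
      · exact h
    obtain ⟨l, rfl⟩ := hqr
    have hqodd := hq.odd_of_ne_two hq2
    have hdiv : 2 * (q * l) / q = 2 * l := by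
      rw [show 2 * (q * l) = q * (2 * l) by ring, Nat.mul_div_cancel_left _ hq.pos]
    have hsqq : ¬ q * q ∣ 2 * (q * l) := by
      intro h
      rw [show 2 * (q * l) = q * (2 * l) by ring] at h
      have h1 : q ∣ 2 * l := Nat.dvd_of_mul_dvd_mul_left hq.pos h
      rcases (Nat.Prime.dvd_mul hq).mp h1 with h | h
      · exact hq2 ((Nat.prime_dvd_prime_iff_eq hq Nat.prime_two).mp h)
      · obtain ⟨j, rfl⟩ := h
        exact hsq q hq ⟨p * j, by ring⟩
    have hcl : ∀ δ : ℂ, ∀ γ ∈ Γ, ∑ u ∈ A γ with y u ^ (2 * l) = δ, y u =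
        ∑ u ∈ A γ0 with y u ^ (2 * l) = δ, y u := by
      intro δ γ hγ
      by_cases hγγ : γ = γ0
      · rw [hγγ]
      have hγ' : γ ∈ Γ.erase γ0 := Finset.mem_erase.mpr ⟨hγγ, hγ⟩
      have h1 := (hQ γ hγ').2 q hq (hno' γ hγ') ⟨2 * l, by ring⟩ hsqq δ
      rw [hdiv] at h1
      simp only [hx'p] at h1
      rw [Finset.filter_union, Finset.sum_union
        (Finset.disjoint_filter_filter (hdisj γ hγ')),
        hx'1 γ hγ' _ (Finset.filter_subset _ _), hx'0 _ (Finset.filter_subset _ _)] at h1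
      linear_combination h1
    have hall : ∀ δ : ℂ, ∑ u ∈ s with y u ^ (2 * l) = δ, x u = 0 := by
      intro δ
      rw [← Finset.sum_fiberwise_of_maps_to (t := Γ) (g := η)
        (fun u hu => hηΓ u (Finset.mem_filter.mp hu).1)]
      have : ∀ γ ∈ Γ, ∑ u ∈ s.filter (fun u => y u ^ (2 * l) = δ) with η u = γ, x u =
          γ * ∑ u ∈ A γ0 with y u ^ (2 * l) = δ, y u := by
        intro γ hγ
        rw [Finset.filter_comm, ← hcl δ γ hγ, ← hxA γ _ (Finset.filter_subset _ _)]
      rw [Finset.sum_congr rfl this, ← Finset.sum_mul, hΓ0, zero_mul]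
    have hyc := hconst (fun u => y u ^ (2 * l)) hall
    obtain ⟨u, hu, v, hv, huv⟩ := hrd q hq hqn
    apply huv
    have hd2 : p * (q * l) / q = p * l := by
      rw [show p * (q * l) = q * (p * l) by ring, Nat.mul_div_cancel_left _ hq.pos]
    rw [hd2]
    obtain ⟨k, hk⟩ := hqodd
    have e1 : ∀ w ∈ s, x w ^ (2 * (p * l)) = (y w ^ (2 * l)) ^ p := by
      intro w hw
      rw [show 2 * (p * l) = p * (2 * l) by ring]
      have h9 : x w ^ (p * (2 * l)) = (η w * y w) ^ (p * (2 * l)) := by rw [hxy w hw]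
      rw [h9, mul_pow, pow_mul (η w), hη w hw, one_pow, one_mul, mul_comm p]
      exact pow_mul (y w) (2 * l) p
    have e2 : x u ^ (2 * (p * l)) = x v ^ (2 * (p * l)) := by
      rw [e1 u hu, e1 v hv]
      rw [hyc u hu v hv]
    have e3 : ∀ w ∈ s, (x w ^ (2 * (p * l))) ^ k * x w ^ (p * l) = 1 := by
      intro w hw
      rw [← pow_mul, ← pow_add, ← hx w hw, hk]
      congr 1
      ring
    have e4 := (e3 u hu).trans (e3 v hv).symm
    rw [e2] at e4
    exact mul_left_cancel₀ (pow_ne_zero _ (pow_ne_zero _ (hx0 v hv))) e4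
  choose i hi using hcover
  have hTcard : 2 * T.card + 1 ≤ Γ.card := by
    rw [hΓc]
    refine card_odd_primes T p (fun q hq => ?_) hpodd
    obtain ⟨h1, h2, h3, h4⟩ := hTp q hq
    have h5 := hpmax q (Nat.mem_primeFactors.mpr ⟨h1, h4, hn.ne'⟩)
    have h6 := h1.two_le
    exact ⟨h1.odd_of_ne_two h2, by omega, by omega⟩
  have hfin := arith Γ γ0 hγ0 (fun γ => (A γ).card) (hAne γ0 hγ0) hγmin T hTcard i
    (fun q hq => (hi q hq).1) (fun γ hγ => by
      refine le_trans ?_ (hQ γ hγ).1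
      refine Nat.add_le_add_left (Finset.sum_le_sum_of_subset ?_) 2
      intro q hq
      obtain ⟨h1, h2⟩ := Finset.mem_filter.mp hq
      exact h2 ▸ (hi q h1).2)
  have hcs : ∑ γ ∈ Γ, (A γ).card = s.card := (Finset.card_eq_sum_card_fiberwise hηΓ).symm
  have hs1 := Finset.add_sum_erase _ (fun q => q - 2) hpn
  have hs2 : ∑ q ∈ T, (q - 2) = ∑ q ∈ ((p * r).primeFactors).erase p, (q - 2) :=
    Finset.sum_erase _ rfl
  omega

theorem conway_jones (n : ℕ) : 0 < n → ∀ (s : Finset ι) (x : ι → ℂ), (∀ u ∈ s, x u ≠ 0) →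
    Mn s x → Rd s x n → 2 + ∑ p ∈ n.primeFactors, (p - 2) ≤ s.card := by
  induction n using Nat.strong_induction_on with
  | _ n ih =>
  intro hn s x hx hm hr
  obtain ⟨u0, hu0⟩ := hm.1
  have h0 := hx u0 hu0
  have hsum : ∀ t : Finset ι, ∑ u ∈ t, x u / x u0 = (∑ u ∈ t, x u) / x u0 := fun t =>
    (Finset.sum_div _ _ _).symm
  refine step n hn ih s (fun u => x u / x u0) ?_ ⟨hm.1, ?_, ?_⟩ ?_
  · intro u hu
    rw [div_pow, hr.1 u hu u0 hu0, div_self (pow_ne_zero _ h0)]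
  · rw [hsum, hm.2.1, zero_div]
  · intro t ht htn h
    rw [hsum, div_eq_zero_iff] at h
    exact hm.2.2 t ht htn (h.resolve_right h0)
  · intro p hp hpn
    obtain ⟨u, hu, v, hv, huv⟩ := hr.2 p hp hpn
    refine ⟨u, hu, v, hv, fun h => huv ?_⟩
    rw [div_pow, div_pow] at h
    exact (div_left_inj' (pow_ne_zero _ h0)).mp h

end

section
variable {m : ℕ} [NeZero m]

local notation "ee" => (ZMod.stdAddChar : AddChar (ZMod m) ℂ)

lemma zeta_pow (i : ZMod m) : zetaC m ^ i.val = ee i := by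
  have h := ZMod.stdAddChar_coe (N := m) (i.val : ℤ)
  have h2 : (((i.val : ℤ)) : ZMod m) = i := by simp
  rw [h2] at h
  rw [h, zetaC, ← Complex.exp_nat_mul]
  congr 1
  push_cast
  ring

lemma min_bound (b : ZMod m → ℕ) (e : ℕ) (hb : IsMinimalVSum m b) (he : HasReducedExponent m b e) :
    2 + ∑ p ∈ e.primeFactors, (p - 2) ≤ ∑ i, b i := by
  classical
  obtain ⟨⟨hb0, hbs⟩, hbm⟩ := hb
  simp only [zeta_pow] at hbs hbm
  obtain ⟨⟨he0, j, hj, hje⟩, hel⟩ := he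
  let s : Finset (Σ _ : ZMod m, ℕ) := (Finset.univ : Finset (ZMod m)).sigma (fun i => range (b i))
  let x : (Σ _ : ZMod m, ℕ) → ℂ := fun u => ee u.1
  have hcard : s.card = ∑ i, b i := by simp [s, Finset.card_sigma]
  have hpow : ∀ (a : ℕ) (z : ZMod m), ee z ^ a = ee (a • z) := fun a z =>
    (AddChar.map_nsmul_eq_pow _ a z).symm
  have hmem : ∀ u, u ∈ s ↔ u.2 < b u.1 := fun u => by simp [s]
  have hjs : (⟨j, 0⟩ : Σ _ : ZMod m, ℕ) ∈ s := (hmem _).mpr (Nat.pos_of_ne_zero hj)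
  rw [← hcard]
  refine conway_jones e he0 s x ?_ ⟨⟨_, hjs⟩, ?_, ?_⟩ ⟨?_, ?_⟩
  · intro u _ h0
    have := AddChar.map_add_eq_mul ee u.1 (-u.1)
    rw [show ee u.1 = 0 from h0] at this
    simp at this
  · simp only [s, x, Finset.sum_sigma]
    simpa using hbs
  · intro t ht htn h0
    have h1 := hbm (fun i => (t.filter fun u => u.1 = i).card) ?_ ?_ ?_
    · apply Finset.eq_of_subset_of_card_le ht
      rw [hcard, ← h1]
      exact (Finset.card_eq_sum_card_fiberwise (fun u _ => Finset.mem_coe.mpr (Finset.mem_univ u.1))).ge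
    · intro i
      rw [← Finset.card_range (b i)]
      apply Finset.card_le_card_of_injOn (fun u => u.2)
      · intro u hu
        obtain ⟨h2, rfl⟩ := Finset.mem_filter.mp hu
        simpa using (hmem u).mp (ht h2)
      · rintro ⟨u1, u2⟩ hu ⟨v1, v2⟩ hv huv
        obtain ⟨_, h2⟩ := Finset.mem_filter.mp hu
        obtain ⟨_, h3⟩ := Finset.mem_filter.mp hv
        simp only at h2 h3 huv
        subst h2 h3 huv
        rfl
    · obtain ⟨u, hu⟩ := htn
      intro h
      have := congrFun h u.1
      simp only [Pi.zero_apply, Finset.card_eq_zero] at this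
      have h3 : u ∈ t.filter fun v => v.1 = u.1 := Finset.mem_filter.mpr ⟨hu, rfl⟩
      rw [this] at h3
      simp at h3
    · rw [← h0, ← Finset.sum_fiberwise t (fun u => u.1)]
      refine Finset.sum_congr rfl fun i _ => ?_
      rw [← nsmul_eq_mul, ← Finset.sum_const]
      refine Finset.sum_congr rfl fun u hu => ?_
      simp only [x]
      rw [(Finset.mem_filter.mp hu).2]
  · have key : ∀ u ∈ s, x u ^ e = ee (e • j) := by
      intro u hu
      simp only [x]
      rw [hpow]
      have := hje u.1 (by have := (hmem u).mp hu; omega)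
      rw [smul_sub, sub_eq_zero] at this
      rw [this]
    intro u hu v hv
    rw [key u hu, key v hv]
  · intro p hp hpe
    by_contra! hc
    have h1 : e ≤ e / p := hel ⟨Nat.div_pos (Nat.le_of_dvd he0 hpe) hp.pos, j, hj, fun i hi => by
      have := hc ⟨i, 0⟩ ((hmem _).mpr (Nat.pos_of_ne_zero hi)) _ hjs
      simp only [x] at this
      rw [hpow, hpow] at this
      rw [smul_sub, ee_inj this, sub_self]⟩
    exact absurd h1 (not_le.mpr (Nat.div_lt_self he0 hp.one_lt))

lemma min_rep (b : ZMod m → ℕ) (e : ℕ) (hb : IsMinimalVSum m b) (he : HasReducedExponent m b e) :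
    Rep m e.primeFactors (fun z => (b z : ℤ)) := by
  obtain ⟨⟨hb0, hbs⟩, hbm⟩ := hb
  simp only [zeta_pow] at hbs
  obtain ⟨⟨he0, j, hj, hje⟩, hel⟩ := he
  have h1 := sum_translate (fun z => (b z : ℤ)) j (by simpa using hbs)
  have h2 := rep_main e he0 (fun z => (b (z + j) : ℤ)) (fun z hz => by
    have := hje (z + j) (by exact_mod_cast hz)
    simpa using this) h1
  simpa using h2.translate j

end
end CJ

theorem stmt_19 (m : ℕ) [NeZero m] (a : ZMod m → ℕ) (k : ℕ)
    (ha : IsVSum m a) (hk : HasCExponent m a k) :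
    (2 + ∑ p ∈ k.primeFactors, (p - 2) ≤ ∑ i : ZMod m, a i) ∧
    (∃ E : ℕ → ZMod m → ℤ, ∀ z : ZMod m,
      (a z : ℤ) = ∑ p ∈ k.primeFactors,
        ∑ w ∈ Finset.univ.filter (fun w : ZMod m => p • w = 0), E p (z - w)) := by
  classical
  obtain ⟨⟨hk0, t, b, e, hb, hab, he, hke⟩, -⟩ := hk
  have hdvd : ∀ j, e j ∣ k := fun j => hke ▸ Finset.dvd_lcm (Finset.mem_univ j)
  constructor
  · have ht : 1 ≤ t := by
      rcases Nat.eq_zero_or_pos t with rfl | h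
      · exact absurd (by simpa using hab) ha.1
      · exact h
    have hsum : ∑ i, a i = ∑ j, ∑ i, b j i := by
      rw [Finset.sum_comm, hab]
      simp
    have h1 : ∑ j, (2 + ∑ p ∈ (e j).primeFactors, (p - 2)) ≤ ∑ i, a i := by
      rw [hsum]
      exact Finset.sum_le_sum fun j _ => CJ.min_bound _ _ (hb j) (he j)
    rw [Finset.sum_add_distrib] at h1
    simp only [Finset.sum_const, Finset.card_univ, Fintype.card_fin, smul_eq_mul] at h1
    have h2 : ∑ p ∈ k.primeFactors, (p - 2) ≤ ∑ j, ∑ p ∈ (e j).primeFactors, (p - 2) := by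
      have h3 : ∀ j, ∑ p ∈ (e j).primeFactors, (p - 2) =
          ∑ p ∈ k.primeFactors, if p ∈ (e j).primeFactors then (p - 2) else 0 := by
        intro j
        rw [← Finset.sum_filter, Finset.filter_mem_eq_inter,
          Finset.inter_eq_right.mpr (Nat.primeFactors_mono (hdvd j) hk0.ne')]
      simp only [h3]
      rw [Finset.sum_comm]
      refine Finset.sum_le_sum fun p hp => ?_
      have hpp := Nat.prime_of_mem_primeFactors hp
      have hpd : p ∣ ∏ j, e j := by
        refine (Nat.dvd_of_mem_primeFactors hp).trans ?_
        rw [hke]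
        exact Finset.lcm_dvd fun j hj => Finset.dvd_prod_of_mem e hj
      obtain ⟨j, _, hj⟩ := (Prime.dvd_finsetProd_iff hpp.prime e).mp hpd
      have hmem : p ∈ (e j).primeFactors :=
        Nat.mem_primeFactors.mpr ⟨hpp, hj, (he j).1.1.ne'⟩
      have := Finset.single_le_sum
        (f := fun j => if p ∈ (e j).primeFactors then (p - 2) else 0)
        (fun j _ => Nat.zero_le _) (Finset.mem_univ j)
      simp only [hmem, if_true] at this
      exact this
    omega
  · have := CJ.Rep.sum (S := k.primeFactors) Finset.univ (fun j z => (b j z : ℤ))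
      (fun j _ => (CJ.min_rep _ _ (hb j) (he j)).mono
        (Nat.primeFactors_mono (hdvd j) hk0.ne'))
    obtain ⟨E, hE⟩ := this
    refine ⟨E, fun z => ?_⟩
    rw [← hE z, hab]
    simp
end
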